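/- arXiv:1701.04086 — 4 statements merged into one kernel-verified Lean document; each statement's English description precedes it below -/
import Mathlib

section
/- Let F be a Gap Algebra such that some operation of F is not {0,2}{1,2}-projective. Then for every finite subset Δ of Inv(F), the clone Pol(Δ) is collapsible. -/
/-- The three-element domain. -/
abbrev D : Type := Fin 3

/-- A finitary operation on `D`, packaged with its arity. -/
abbrev Op : Type := Σ n : ℕ, (Fin n → D) → D

/-- The semilattice-without-unit operation `s`: `s(x,x) = x`, `s(x,y) = 2` for `x ≠ y`. -/
def sFun : (Fin 2 → D) → D := fun x => if x 0 = x 1 then x 0 else 2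

/-- `s` as a packaged operation. -/
def sOp : Op := ⟨2, sFun⟩

/-- The clone generated by a set `F` of operations on `D`: the smallest set of
operations containing `F` and all projections and closed under composition. -/
inductive InClone (F : Set Op) : Op → Prop
  | base {g : Op} : g ∈ F → InClone F g
  | proj {n : ℕ} (i : Fin n) : InClone F ⟨n, fun x => x i⟩
  | comp {n m : ℕ} (f : (Fin n → D) → D) (g : Fin n → (Fin m → D) → D) :
      InClone F ⟨n, f⟩ → (∀ i, InClone F ⟨m, g i⟩) →
      InClone F ⟨m, fun x => f (fun i => g i x)⟩

/-- Closure of a set `S ⊆ D^m` under coordinatewise applications of operations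
of the clone generated by `F`. -/
inductive InClosure (F : Set Op) {m : ℕ} (S : Set (Fin m → D)) : (Fin m → D) → Prop
  | base {t : Fin m → D} : t ∈ S → InClosure F S t
  | app {n : ℕ} (f : (Fin n → D) → D) (ts : Fin n → Fin m → D) :
      InClone F ⟨n, f⟩ → (∀ i, InClosure F S (ts i)) →
      InClosure F S (fun j => f (fun i => ts i j))

/-- `Λ_{m,k}`: the tuples of `D^m` in which at least `m - k` coordinates are equal. -/
def Lam (m k : ℕ) : Set (Fin m → D) :=
  {x | ∃ a : D, m - k ≤ Set.ncard {i : Fin m | x i = a}}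

/-- `F` is `k`-collapsible. -/
def KCollapsible (F : Set Op) (k : ℕ) : Prop :=
  ∀ m : ℕ, 1 ≤ m → ∀ t : Fin m → D, InClosure F (Lam m k) t

/-- `F` is collapsible: `k`-collapsible for some `k`. -/
def Collapsible (F : Set Op) : Prop := ∃ k, KCollapsible F k

/-- An operation is idempotent. -/
def Idem {n : ℕ} (g : (Fin n → D) → D) : Prop := ∀ x : D, g (fun _ => x) = x

/-- An operation preserves a subset `B ⊆ D`. -/
def PreservesSet {n : ℕ} (g : (Fin n → D) → D) (B : Set D) : Prop :=
  ∀ x : Fin n → D, (∀ i, x i ∈ B) → g x ∈ B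

/-- A tuple lies in `{0,1}^n`. -/
def Bool01 {n : ℕ} (x : Fin n → D) : Prop := ∀ j, x j = 0 ∨ x j = 1

/-- Property (*): for each coordinate `i` there is `x ∈ {0,1}^k` with
`f(x) ∈ {0,1}` and `f(x) ≠ x_i`. -/
def PropStar {k : ℕ} (f : (Fin k → D) → D) : Prop :=
  ∀ i : Fin k, ∃ x : Fin k → D, Bool01 x ∧ (f x = 0 ∨ f x = 1) ∧ f x ≠ x i

/-- Class (i): coordinates with a `0 ↦ 1` witness but no `1 ↦ 0` witness. -/
def ClassI {k : ℕ} (f : (Fin k → D) → D) : Set (Fin k) :=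
  {i | (∃ x, Bool01 x ∧ x i = 0 ∧ f x = 1) ∧ ¬ ∃ x, Bool01 x ∧ x i = 1 ∧ f x = 0}

/-- Class (ii): coordinates with a `1 ↦ 0` witness but no `0 ↦ 1` witness. -/
def ClassII {k : ℕ} (f : (Fin k → D) → D) : Set (Fin k) :=
  {i | (∃ x, Bool01 x ∧ x i = 1 ∧ f x = 0) ∧ ¬ ∃ x, Bool01 x ∧ x i = 0 ∧ f x = 1}

/-- An n-ary operation preserves an h-ary relation on `D`. -/
def OpPreservesRel {n h : ℕ} (g : (Fin n → D) → D) (ρ : Set (Fin h → D)) : Prop :=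
  ∀ t : Fin n → Fin h → D, (∀ i, t i ∈ ρ) → (fun j => g (fun i => t i j)) ∈ ρ

/-- `ρ ∈ Inv(F)`: the relation is preserved by every operation of `F`. -/
def InInv (F : Set Op) {h : ℕ} (ρ : Set (Fin h → D)) : Prop :=
  ∀ g ∈ F, OpPreservesRel g.2 ρ

/-- A Gap Algebra: a set of idempotent operations on `D` containing `s`,
all preserving `{0,2}` and `{1,2}`, that is not collapsible. -/
def GapAlgebra (F : Set Op) : Prop :=
  sOp ∈ F ∧
  (∀ g ∈ F, Idem g.2 ∧ PreservesSet g.2 {0, 2} ∧ PreservesSet g.2 {1, 2}) ∧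
  ¬ Collapsible F

/-- An operation is `{0,2}{1,2}`-projective. -/
def Proj0212 {n : ℕ} (g : (Fin n → D) → D) : Prop :=
  ∃ i : Fin n, ∀ x : Fin n → D,
    (x i ∈ ({0, 2} : Set D) → g x ∈ ({0, 2} : Set D)) ∧
    (x i ∈ ({1, 2} : Set D) → g x ∈ ({1, 2} : Set D))

/-- The Zhuk Condition for a set `F` of operations on `D`. -/
def ZhukCondition (F : Set Op) : Prop :=
  ∃ p : (Fin 2 → D) → D, ∃ r₃ : (Fin 3 → D) → D,
    InClone F ⟨2, p⟩ ∧ InClone F ⟨3, r₃⟩ ∧ Idem p ∧ Idem r₃ ∧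
    ((p ![0, 1] = 0 ∧ p ![0, 2] = 2 ∧
      r₃ ![0, 0, 1] = 0 ∧ r₃ ![0, 1, 0] = 0 ∧ r₃ ![0, 1, 1] = 2) ∨
     (p ![0, 1] = 1 ∧ p ![2, 1] = 2 ∧
      r₃ ![1, 0, 1] = 1 ∧ r₃ ![1, 1, 0] = 1 ∧ r₃ ![1, 0, 0] = 2))

/-- A finitary relation on `D`, packaged with its arity. -/
abbrev RelD : Type := Σ h : ℕ, Set (Fin h → D)

/-- `Pol(Δ)`: the operations preserving every relation of `Δ`. -/
def PolSet (Δ : Set RelD) : Set Op := {g | ∀ ρ ∈ Δ, OpPreservesRel g.2 ρ.2}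


/-- `p` and `q` are the two elements `0`, `1` of `D`, in some order. -/
def IsPair (p q : D) : Prop := p ≠ q ∧ p ≠ 2 ∧ q ≠ 2

theorem IsPair.symm {p q : D} (h : IsPair p q) : IsPair q p := ⟨h.1.symm, h.2.2, h.2.1⟩

theorem IsPair.cases {p q : D} (h : IsPair p q) (x : D) : x = p ∨ x = q ∨ x = 2 := by
  obtain ⟨h1, h2, h3⟩ := h
  revert p q x
  decide

theorem IsPair.eq_of_ne {p q x : D} (h : IsPair p q) (h2 : x ≠ 2) (hp : x ≠ p) : x = q := by
  rcases h.cases x with h | h | h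
  · exact absurd h hp
  · exact h
  · exact absurd h h2

theorem IsPair.exists_pair {p : D} (hp : p ≠ 2) : ∃ q, IsPair p q := by
  unfold IsPair
  revert p
  decide

/-- The standing assumptions on a set of operations. -/
def Admissible (F : Set Op) : Prop :=
  sOp ∈ F ∧ ∀ g ∈ F, Idem g.2 ∧ PreservesSet g.2 {0, 2} ∧ PreservesSet g.2 {1, 2}

section Clone

variable {F : Set Op}

theorem InClone.idem (hF : Admissible F) {g : Op} (hg : InClone F g) : Idem g.2 := by
  induction hg with
  | base h => exact (hF.2 _ h).1
  | proj i => intro x; rfl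
  | comp f g _ _ ihf ihg =>
    intro x
    have : (fun i => g i (fun _ => x)) = fun _ => x := funext fun i => ihg i x
    simpa only [this] using ihf x

theorem InClone.preservesRel {h : ℕ} {ρ : Set (Fin h → D)} (hρ : InInv F ρ) {g : Op}
    (hg : InClone F g) : OpPreservesRel g.2 ρ := by
  induction hg with
  | base hg => exact hρ _ hg
  | proj i => intro t ht; exact ht i
  | comp f g _ _ ihf ihg => intro t ht; exact ihf _ fun i => ihg i t ht

theorem InClone.join (hF : Admissible F) {n : ℕ} {g g' : (Fin n → D) → D}
    (hg : InClone F ⟨n, g⟩) (hg' : InClone F ⟨n, g'⟩) :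
    InClone F ⟨n, fun x => if g x = g' x then g x else 2⟩ :=
  InClone.comp sFun ![g, g'] (InClone.base hF.1) fun i => by
    fin_cases i
    · exact hg
    · exact hg'

theorem InClosure.join (hF : sOp ∈ F) {m : ℕ} {S : Set (Fin m → D)} {x y : Fin m → D}
    (hx : InClosure F S x) (hy : InClosure F S y) :
    InClosure F S (fun j => if x j = y j then x j else 2) :=
  InClosure.app sFun ![x, y] (InClone.base hF) fun i => by
    fin_cases i
    · exact hx
    · exact hy

theorem mem_Lam_of_card {m k : ℕ} {x : Fin m → D} (a : D)
    (h : (Finset.univ.filter fun j => x j ≠ a).card ≤ k) : x ∈ Lam m k := by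
  refine ⟨a, ?_⟩
  have h1 : {j | x j = a} =
      ((Finset.univ.filter fun j => x j = a : Finset (Fin m)) : Set (Fin m)) := by
    ext; simp
  rw [h1, Set.ncard_coe_finset]
  have := Finset.card_filter_add_card_filter_not (s := (Finset.univ : Finset (Fin m)))
    (fun j => x j = a)
  simp only [Finset.card_univ, Fintype.card_fin] at this
  simp only [ne_eq] at h
  omega

/-- A tuple with few entries `q` is generated by the tuples that are almost constant. -/
theorem closure_of_card_le (hF : sOp ∈ F) {p q : D} (hpq : IsPair p q) {m k : ℕ}
    (τ : Fin m → D) (h : (Finset.univ.filter fun j => τ j = q).card ≤ k) :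
    InClosure F (Lam m (k + 1)) τ := by
  induction hN : (Finset.univ.filter fun j => τ j = 2).card using Nat.strong_induction_on
    generalizing τ with
  | _ N ih =>
  by_cases h1 : N ≤ 1
  · refine .base (mem_Lam_of_card p ?_)
    refine (Finset.card_le_card (t := (Finset.univ.filter fun j => τ j = q) ∪
      (Finset.univ.filter fun j => τ j = 2)) ?_).trans
      ((Finset.card_union_le _ _).trans (by omega))
    intro j hj
    have := hpq.cases (τ j)
    simp only [Finset.mem_filter, Finset.mem_univ, true_and, Finset.mem_union] at hj ⊢
    tauto
  · obtain ⟨a, ha, b, hb, hab⟩ := Finset.one_lt_card.1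
      (by omega : 1 < (Finset.univ.filter fun j => τ j = 2).card)
    simp only [Finset.mem_filter, Finset.mem_univ, true_and] at ha hb
    have step : ∀ c, τ c = 2 → InClosure F (Lam m (k + 1)) (Function.update τ c p) := by
      intro c hc
      refine ih _ ?_ (Function.update τ c p) ?_ rfl
      · rw [← hN]
        refine Finset.card_lt_card ⟨?_, fun hsub => ?_⟩
        · intro j hj
          simp only [Finset.mem_filter, Finset.mem_univ, true_and, Function.update_apply] at hj ⊢
          split_ifs at hj with hjc
          · exact absurd hj hpq.2.1
          · exact hj
        · have := hsub (show c ∈ _ by simpa using hc)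
          simp [hpq.2.1] at this
      · refine (Finset.card_le_card ?_).trans h
        intro j hj
        simp only [Finset.mem_filter, Finset.mem_univ, true_and, Function.update_apply] at hj ⊢
        split_ifs at hj with hjc
        · exact absurd hj hpq.1
        · exact hj
    convert InClosure.join hF (step a ha) (step b hb) using 1
    funext j
    simp only [Function.update_apply]
    by_cases hja : j = a
    · subst hja
      simp [hab, ha, hpq.2.1]
    · by_cases hjb : j = b
      · subst hjb
        simp [hja, hb, hpq.2.1.symm]
      · simp [hja, hjb]

theorem collapsible_of_bool (hF : sOp ∈ F) {k : ℕ}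
    (h : ∀ m (t : Fin m → D), (∀ j, t j ≠ 2) → InClosure F (Lam m k) t) : Collapsible F := by
  refine ⟨k, fun m _ t => ?_⟩
  have key : ∀ c : D, c ≠ 2 → InClosure F (Lam m k) (fun j => if t j = 2 then c else t j) := by
    intro c hc
    refine h m _ fun j => ?_
    split_ifs with hj
    · exact hc
    · exact hj
  convert InClosure.join hF (key 0 (by decide)) (key 1 (by decide)) using 1
  funext j
  by_cases hj : t j = 2 <;> simp [hj]

/-- Summing a weight over a vector modified along an embedding. -/
theorem sum_extend_lt {m : ℕ} {ι : Type*} [Fintype ι] (e : ι ↪ Fin m) (ω : D → ℕ)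
    (x : ι → D) (τ : Fin m → D) (h : ∑ s, ω (x s) < ∑ s, ω (τ (e s))) :
    ∑ j, ω (Function.extend e x τ j) < ∑ j, ω (τ j) := by
  classical
  rw [← Finset.sum_add_sum_compl (Finset.univ.map e), ← Finset.sum_add_sum_compl (Finset.univ.map e)
    (fun j => ω (τ j)), Finset.sum_map, Finset.sum_map]
  have : ∑ j ∈ (Finset.univ.map e)ᶜ, ω (Function.extend e x τ j) =
      ∑ j ∈ (Finset.univ.map e)ᶜ, ω (τ j) := by
    refine Finset.sum_congr rfl fun j hj => ?_
    rw [Function.extend_apply']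
    simpa using hj
  rw [this]
  simpa [e.injective.extend_apply] using h

/-- If all columns of a matrix whose rows are mapped to the entries of `τ` are generated, so is
`τ`. -/
theorem closure_of_extend {m n k : ℕ} {f : (Fin n → D) → D} (hf : InClone F ⟨n, f⟩)
    {ι : Type*} (e : ι ↪ Fin m) (x : ι → Fin n → D) (base : Fin m → Fin n → D) (τ : Fin m → D)
    (hx : ∀ s, f (x s) = τ (e s)) (hbase : ∀ j, f (base j) = τ j)
    (h : ∀ i, InClosure F (Lam m k) (Function.extend e (fun s => x s i) (fun j => base j i))) :
    InClosure F (Lam m k) τ := by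
  convert InClosure.app f _ hf h using 1
  funext j
  by_cases hj : ∃ s, e s = j
  · obtain ⟨s, rfl⟩ := hj
    simp only [e.injective.extend_apply, hx]
  · simp only [Function.extend_apply' _ _ _ hj, hbase]

theorem exists_embedding_of_card_le {m : ℕ} {α : Type*} [Fintype α] {τ : Fin m → D} {q : D}
    (h : Fintype.card α ≤ (Finset.univ.filter fun j => τ j = q).card) :
    ∃ e : α ↪ Fin m, ∀ s, τ (e s) = q := by
  obtain ⟨e⟩ : Nonempty (α ↪ {j // τ j = q}) :=
    Function.Embedding.nonempty_of_card_le (by rwa [Fintype.card_subtype])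
  exact ⟨e.trans (Function.Embedding.subtype _), fun s => (e s).2⟩

/-- The main recursion: an operation that expresses `q` and `p` through rows of smaller total
weight makes the algebra collapsible. -/
theorem collapsible_of_weight (hF : Admissible F) {p q : D} (hpq : IsPair p q) {n : ℕ}
    {f : (Fin n → D) → D} (hf : InClone F ⟨n, f⟩) {α β : Type} [Fintype α] [Fintype β]
    (X : α → Fin n → D) (Y : β → Fin n → D) (hX : ∀ s, f (X s) = q) (hY : ∀ s, f (Y s) = p)
    (ω : D → ℕ)
    (h : ∀ i, ∑ s, ω (X s i) + ∑ s, ω (Y s i) < Fintype.card α * ω q + Fintype.card β * ω p) :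
    Collapsible F := by
  refine ⟨Fintype.card α + Fintype.card β + 1, fun m _ τ => ?_⟩
  induction hN : ∑ j, ω (τ j) using Nat.strong_induction_on generalizing τ with
  | _ N ih =>
  by_cases hq : (Finset.univ.filter fun j => τ j = q).card < Fintype.card α
  · exact closure_of_card_le hF.1 hpq τ (by omega)
  by_cases hp : (Finset.univ.filter fun j => τ j = p).card < Fintype.card β
  · exact closure_of_card_le hF.1 hpq.symm τ (by omega)
  obtain ⟨e₁, he₁⟩ := exists_embedding_of_card_le (not_lt.1 hq)
  obtain ⟨e₂, he₂⟩ := exists_embedding_of_card_le (not_lt.1 hp)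
  let e : α ⊕ β ↪ Fin m := ⟨Sum.elim e₁ e₂, by
    refine e₁.injective.sumElim e₂.injective fun a b hab => ?_
    have := he₁ a
    rw [hab, he₂ b] at this
    exact hpq.1 this⟩
  refine closure_of_extend hf e (Sum.elim X Y) (fun j _ => τ j) τ ?_ (fun j => hf.idem hF _) ?_
  · rintro (s | s)
    · exact (hX s).trans (he₁ s).symm
    · exact (hY s).trans (he₂ s).symm
  · intro i
    refine ih _ ?_ _ rfl
    rw [← hN]
    refine sum_extend_lt e ω _ τ ?_
    simpa [Fintype.sum_sum_type, e, he₁, he₂] using h i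

/-- If a single row of value `p` has entry `q` wherever no row of value `q` has entry `p`, the
algebra is collapsible. -/
theorem collapsible_of_dominating (hF : Admissible F) {p q : D} (hpq : IsPair p q) {n : ℕ}
    {f : (Fin n → D) → D} (hf : InClone F ⟨n, f⟩) (y : Fin n → D) (hy2 : ∀ i, y i ≠ 2)
    (hy : f y = p)
    (h : ∀ i, y i = p → ∃ x : Fin n → D, (∀ j, x j ≠ 2) ∧ f x = q ∧ x i = p) :
    Collapsible F := by
  have hX : ∀ i, ∃ x : Fin n → D, (∀ j, x j ≠ 2) ∧ f x = q ∧ (y i = p → x i = p) := by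
    intro i
    by_cases hi : y i = p
    · obtain ⟨x, h1, h2, h3⟩ := h i hi
      exact ⟨x, h1, h2, fun _ => h3⟩
    · exact ⟨fun _ => q, fun _ => hpq.2.2, hf.idem hF q, fun h => absurd h hi⟩
  choose X hX2 hXq hXp using hX
  refine collapsible_of_bool hF.1 (k := n) fun m τ hτ => ?_
  let ω : D → ℕ := fun d => if d = q then 1 else 0
  induction hN : ∑ j, ω (τ j) using Nat.strong_induction_on generalizing τ with
  | _ N ih =>
  by_cases hq : (Finset.univ.filter fun j => τ j = q).card ≤ n
  · refine .base (mem_Lam_of_card p ((Finset.card_le_card ?_).trans hq))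
    intro j hj
    simp only [Finset.mem_filter, Finset.mem_univ, true_and] at hj ⊢
    exact hpq.eq_of_ne (hτ j) hj
  obtain ⟨e, he⟩ := exists_embedding_of_card_le (α := Fin n) (τ := τ) (q := q)
    (by rw [Fintype.card_fin]; omega)
  refine closure_of_extend hf e X (fun j => if τ j = p then y else fun _ => τ j) τ
    (fun s => (hXq s).trans (he s).symm) ?_ ?_
  · intro j
    split_ifs with hj
    · rw [hy, hj]
    · exact hf.idem hF _
  · intro i
    by_cases hi : y i = p
    · have hb : (fun j => (if τ j = p then y else fun _ => τ j) i) = τ := by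
        funext j
        split_ifs with hj
        · rw [hi, hj]
        · rfl
      rw [hb]
      refine ih _ ?_ _ (fun j => ?_) rfl
      · rw [← hN]
        refine sum_extend_lt e ω _ τ (Finset.sum_lt_sum (fun s _ => ?_) ⟨i, Finset.mem_univ _, ?_⟩)
        · simp only [he, ω, if_true]
          split_ifs <;> omega
        · simp [he, ω, hXp i hi, hpq.1]
      · by_cases hj : ∃ s, e s = j
        · obtain ⟨s, rfl⟩ := hj
          simpa only [e.injective.extend_apply] using hX2 s i
        · simpa only [Function.extend_apply' _ _ _ hj] using hτ j
    · have hi' := hpq.eq_of_ne (hy2 i) hi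
      refine .base (mem_Lam_of_card q ?_)
      refine (Finset.card_le_card (t := Finset.univ.map e) ?_).trans (by simp)
      intro j hj
      simp only [Finset.mem_filter, Finset.mem_univ, true_and] at hj
      by_contra hj'
      rw [Function.extend_apply' _ _ _ (by simpa using hj')] at hj
      apply hj
      split_ifs with hjp
      · exact hi'
      · exact hpq.eq_of_ne (hτ j) hjp

/-- Two rows of different values without conflicting entries make the algebra collapsible. -/
theorem collapsible_of_compatible (hF : Admissible F) {p q : D} (hpq : IsPair p q) {n : ℕ}
    {f : (Fin n → D) → D} (hf : InClone F ⟨n, f⟩) (w x : Fin n → D) (hw2 : ∀ i, w i ≠ 2)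
    (hw : f w = q) (hx : f x = p) (h : ∀ i, x i = w i ∨ x i = 2) : Collapsible F := by
  refine collapsible_of_bool hF.1 (k := 1) fun m τ hτ => ?_
  have key : ∀ i, InClosure F (Lam m 1) (fun j => if τ j = q then w i else x i) := by
    intro i
    obtain ⟨r, hr⟩ := IsPair.exists_pair (hw2 i)
    refine closure_of_card_le hF.1 hr (k := 0) _ ?_
    rw [Nat.le_zero, Finset.card_eq_zero, Finset.filter_eq_empty_iff]
    intro j _ hj
    split_ifs at hj with hjq
    · exact hr.1 hj
    · rcases h i with h | h
      · exact hr.1 (h ▸ hj)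
      · exact hr.2.2 (h ▸ hj).symm
  convert InClosure.app f _ hf key using 1
  funext j
  by_cases hj : τ j = q
  · simp [hj, hw]
  · simp only [hj, if_false, hx]
    exact hpq.symm.eq_of_ne (hτ j) hj

end Clone

section Witnesses

variable {F : Set Op} {n : ℕ} {f : (Fin n → D) → D} {p q : D}

theorem proj0212_of_forall {i : Fin n} (h : ∀ x, f x ≠ 2 → f x = x i) : Proj0212 f := by
  refine ⟨i, fun x => ?_⟩
  have := h x
  revert this
  generalize f x = a
  generalize x i = b
  simp only [Set.mem_insert_iff, Set.mem_singleton_iff]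
  revert a b
  decide

theorem propStar_iff : PropStar f ↔ ∀ i, ∃ x, (∀ j, x j ≠ 2) ∧ f x ≠ 2 ∧ f x ≠ x i := by
  have key : ∀ d : D, (d = 0 ∨ d = 1) ↔ d ≠ 2 := by decide
  simp only [PropStar, Bool01, key]

theorem proj0212_of_full (hF : Admissible F) (hnc : ¬ Collapsible F) (hf : InClone F ⟨n, f⟩)
    (hpq : IsPair p q) (i : Fin n) (h : ∀ w, (∀ j, w j ≠ 2) → w i = q → f w = q) :
    Proj0212 f := by
  refine proj0212_of_forall (i := i) fun x hx => ?_
  by_contra hne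
  apply hnc
  rcases hpq.cases (f x) with hp | hq | h2
  · refine collapsible_of_compatible hF hpq hf
      (fun j => if x j = 2 then q else x j) x (fun j => ?_) (h _ (fun j => ?_) ?_) hp (fun j => ?_)
    · split_ifs with hj
      exacts [hpq.2.2, hj]
    · split_ifs with hj
      exacts [hpq.2.2, hj]
    · split_ifs with hj
      · rfl
      · exact hpq.eq_of_ne hj fun h => hne (hp.trans h.symm)
    · split_ifs with hj
      exacts [Or.inr hj, Or.inl rfl]
  · have hw := h (fun j => if j = i then q else p) (fun j => by
      split_ifs
      exacts [hpq.2.2, hpq.2.1]) (by simp)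
    refine collapsible_of_weight hF hpq hf (α := Bool) (β := Empty)
      (fun b => if b then fun j => if j = i then q else p else x) (fun e => e.elim)
      (fun b => ?_) (fun e => e.elim) (fun d => if d = q then 1 else 0) fun j => ?_
    · cases b
      exacts [hq, hw]
    · by_cases hj : j = i
      · subst hj
        have hxj : x j ≠ q := fun h => hne (hq.trans h.symm)
        rw [Fintype.sum_bool]
        simp [hxj]
      · rw [Fintype.sum_bool]
        simp only [hj, if_false, if_true, hpq.1, Fintype.card_bool, Finset.univ_eq_empty,
          Finset.sum_empty, Bool.false_eq_true]
        split_ifs <;> omega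
  · exact absurd h2 hx

theorem exists_propStar (hF : Admissible F) (hnc : ¬ Collapsible F) (hf : InClone F ⟨n, f⟩)
    (hproj : ¬ Proj0212 f) : ∃ (N : ℕ) (g : (Fin N → D) → D), InClone F ⟨N, g⟩ ∧ PropStar g := by
  refine ⟨n * n, fun w => f fun i => f fun j => w (finProdFinEquiv (i, j)),
    .comp f _ hf fun i => .comp f _ hf fun j => .proj _, propStar_iff.2 fun k => ?_⟩
  obtain ⟨⟨i, j⟩, rfl⟩ := finProdFinEquiv.surjective k
  suffices h : ∃ M : Fin n → Fin n → D, (∀ i j, M i j ≠ 2) ∧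
      f (fun i => f (M i)) ≠ 2 ∧ f (fun i => f (M i)) ≠ M i j by
    obtain ⟨M, hM⟩ := h
    exact ⟨fun k => M (finProdFinEquiv.symm k).1 (finProdFinEquiv.symm k).2,
      fun k => hM.1 _ _, by simpa using hM.2⟩
  by_cases hj : ∃ w, (∀ l, w l ≠ 2) ∧ f w ≠ 2 ∧ f w ≠ w j
  · obtain ⟨w, hw2, hw, hwj⟩ := hj
    have hM : ∀ l, f (if l = i then w else fun _ => f w) = f w := by
      intro l
      split_ifs
      exacts [rfl, hf.idem hF _]
    refine ⟨fun l => if l = i then w else fun _ => f w, fun l => ?_, ?_⟩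
    · dsimp only
      split_ifs
      exacts [hw2, fun _ => hw]
    · simp only [hM, if_true]
      have := hf.idem hF (f w)
      simp only at this
      rw [this]
      exact ⟨hw, hwj⟩
  · push Not at hj
    obtain ⟨x, hx, hxi⟩ : ∃ x, f x ≠ 2 ∧ f x ≠ x i := by
      by_contra! h
      exact hproj (proj0212_of_forall h)
    obtain ⟨b, hb⟩ := IsPair.exists_pair hx
    obtain ⟨w, hw2, hwj, hw⟩ : ∃ w, (∀ l, w l ≠ 2) ∧ w j = b ∧ f w ≠ b := by
      by_contra! h
      exact hproj (proj0212_of_full hF hnc hf hb j h)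
    have hw' : f w = 2 := by
      by_contra h
      exact hw ((hj w hw2 h).trans hwj)
    have hM : ∀ l, f (if x l = 2 then w else fun _ => x l) = x l := by
      intro l
      split_ifs with hl
      · rw [hw', hl]
      · exact hf.idem hF _
    refine ⟨fun l => if x l = 2 then w else fun _ => x l, fun l k => ?_, ?_⟩
    · dsimp only
      split_ifs with hl
      exacts [hw2 k, hl]
    · simp only [hM]
      refine ⟨hx, ?_⟩
      split_ifs with hl
      · rw [hwj]
        exact hb.1
      · exact hxi

theorem PropStar.cases (hst : PropStar f) (hpq : IsPair p q) (i : Fin n) :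
    (∃ x, (∀ j, x j ≠ 2) ∧ f x = q ∧ x i = p) ∨ ∃ y, (∀ j, y j ≠ 2) ∧ f y = p ∧ y i = q := by
  obtain ⟨x, hx2, hx, hxi⟩ := propStar_iff.1 hst i
  by_cases hp : f x = p
  · exact .inr ⟨x, hx2, hp, hpq.eq_of_ne (hx2 i) fun h => hxi (hp.trans h.symm)⟩
  · have hq := hpq.eq_of_ne hx hp
    exact .inl ⟨x, hx2, hq, hpq.symm.eq_of_ne (hx2 i) fun h => hxi (hq.trans h.symm)⟩

theorem exists_coordinate (hF : Admissible F) (hnc : ¬ Collapsible F) (hf : InClone F ⟨n, f⟩)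
    (hpq : IsPair p q) : ∃ i, ∀ x, (∀ j, x j ≠ 2) → f x = q → x i = q := by
  by_contra! h
  choose X _ hXq hX using h
  refine hnc (collapsible_of_weight hF hpq hf (α := Fin n) (β := Empty) X (fun e => e.elim) hXq
    (fun e => e.elim) (fun d => if d = q then 1 else 0) fun i => ?_)
  refine lt_of_lt_of_eq (b := ∑ _s : Fin n, 1) ?_ (by simp)
  rw [Finset.univ_eq_empty (α := Empty), Finset.sum_empty, add_zero]
  refine Finset.sum_lt_sum (fun s _ => ?_) ⟨i, Finset.mem_univ _, ?_⟩
  · split_ifs <;> omega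
  · simp [hX]

theorem exists_family (hF : Admissible F) (hf : InClone F ⟨n, f⟩) (hpq : IsPair p q) :
    ∃ X : Fin n → Fin n → D, (∀ i j, X i j ≠ 2) ∧ (∀ i, f (X i) = q) ∧
      ∀ i, (∃ x, (∀ j, x j ≠ 2) ∧ f x = q ∧ x i = p) → X i i = p := by
  have hX : ∀ i, ∃ x : Fin n → D, (∀ j, x j ≠ 2) ∧ f x = q ∧
      ((∃ x, (∀ j, x j ≠ 2) ∧ f x = q ∧ x i = p) → x i = p) := by
    intro i
    by_cases hi : ∃ x, (∀ j, x j ≠ 2) ∧ f x = q ∧ x i = p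
    · obtain ⟨x, h1, h2, h3⟩ := hi
      exact ⟨x, h1, h2, fun _ => h3⟩
    · exact ⟨fun _ => q, fun _ => hpq.2.2, hf.idem hF q, fun h => absurd h hi⟩
  choose X h1 h2 h3 using hX
  exact ⟨X, h1, h2, h3⟩

theorem exists_lowered (hF : Admissible F) (hnc : ¬ Collapsible F) (hf : InClone F ⟨n, f⟩)
    (hst : PropStar f) (hpq : IsPair p q) :
    ∃ y, (∀ j, y j ≠ 2) ∧ f y = p ∧ f (fun j => if y j = p then p else 2) ≠ p := by
  by_contra! h
  obtain ⟨X, hX2, hXq, hX⟩ := exists_family hF hf hpq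
  obtain ⟨Y, hY2, hYp, hY⟩ := exists_family hF hf hpq.symm
  obtain ⟨ω, hω⟩ : ∃ ω : D → ℕ, ω = fun d => if d = p then 1 else if d = q then 2 else 0 := ⟨_, rfl⟩
  have ωp : ω p = 1 := by simp [hω]
  have ωq : ω q = 2 := by simp [hω, hpq.1.symm]
  have ω2 : ω 2 = 0 := by simp [hω, hpq.2.1.symm, hpq.2.2.symm]
  refine hnc (collapsible_of_weight hF hpq hf X (fun s j => if Y s j = p then p else 2) hXq
    (fun s => h _ (hY2 s) (hYp s)) ω fun i => ?_)
  rw [← Finset.sum_add_distrib]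
  refine lt_of_lt_of_eq (b := ∑ _s : Fin n, 3) ?_ (by simp [ωp, ωq]; omega)
  have hXle : ∀ s, ω (X s i) ≤ 2 := by
    intro s
    rcases hpq.cases (X s i) with h | h | h <;> simp [h, ωp, ωq, ω2]
  have hYle : ∀ s, ω (if Y s i = p then p else 2) ≤ 1 := by
    intro s
    split_ifs <;> simp [ωp, ω2]
  refine Finset.sum_lt_sum (fun s _ => add_le_add (hXle s) (hYle s)) ⟨i, Finset.mem_univ _, ?_⟩
  rcases hst.cases hpq i with h | h
  · have := hYle i
    rw [hX i h, ωp]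
    omega
  · have := hXle i
    rw [hY i h, if_neg hpq.1.symm, ω2]
    omega

theorem exists_shifted (hF : Admissible F) (hnc : ¬ Collapsible F) (hf : InClone F ⟨n, f⟩)
    (hst : PropStar f) (hpq : IsPair p q) :
    ∃ x, (∀ j, x j ≠ 2) ∧ f x = q ∧ f (fun j => if x j = q then p else 2) ≠ p := by
  by_contra! h
  obtain ⟨X, hX2, hXq, hX⟩ := exists_family hF hf hpq
  obtain ⟨Y, hY2, hYp, hY⟩ := exists_family hF hf hpq.symm
  obtain ⟨ω, hω⟩ : ∃ ω : D → ℕ, ω = fun d => if d = p then 2 else if d = q then 1 else 0 := ⟨_, rfl⟩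
  have ωp : ω p = 2 := by simp [hω]
  have ωq : ω q = 1 := by simp [hω, hpq.1.symm]
  have ω2 : ω 2 = 0 := by simp [hω, hpq.2.1.symm, hpq.2.2.symm]
  refine hnc (collapsible_of_weight hF hpq hf (β := Fin n ⊕ Fin n) X
    (Sum.elim (fun s j => if X s j = q then p else 2) Y) hXq ?_ ω fun i => ?_)
  · rintro (s | s)
    exacts [h _ (hX2 s) (hXq s), hYp s]
  simp only [Fintype.sum_sum_type, Sum.elim_inl, Sum.elim_inr, ← Finset.sum_add_distrib]
  refine lt_of_lt_of_eq (b := ∑ _s : Fin n, 5) ?_ (by simp [ωp, ωq]; omega)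
  have hXle : ∀ s, ω (X s i) + ω (if X s i = q then p else 2) ≤ 3 := by
    intro s
    rcases hpq.cases (X s i) with h | h | h <;> simp [h, ωp, ωq, ω2, hpq.1, hpq.2.2.symm]
  have hYle : ∀ s, ω (Y s i) ≤ 2 := by
    intro s
    rcases hpq.cases (Y s i) with h | h | h <;> simp [h, ωp, ωq, ω2]
  refine Finset.sum_lt_sum (fun s _ => ?_) ⟨i, Finset.mem_univ _, ?_⟩
  · have := hXle s
    have := hYle s
    omega
  rcases hst.cases hpq i with h | h
  · have := hYle i
    rw [hX i h, if_neg hpq.1, ωp, ω2]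
    omega
  · have := hXle i
    rw [hY i h, ωq]
    omega

theorem exists_union (hF : Admissible F) (hnc : ¬ Collapsible F) (hf : InClone F ⟨n, f⟩)
    (hst : PropStar f) (hpq : IsPair p q) :
    ∃ y z, (∀ j, y j ≠ 2) ∧ (∀ j, z j ≠ 2) ∧ f y = p ∧ f z = p ∧
      f (fun j => if y j = q then q else z j) ≠ p := by
  classical
  by_contra! h
  have key : ∀ S : Finset (Fin n → D), ∃ y : Fin n → D, (∀ j, y j ≠ 2) ∧ f y = p ∧
      ∀ z ∈ S, (∀ j, z j ≠ 2) → f z = p → ∀ i, z i = q → y i = q := by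
    intro S
    induction S using Finset.induction_on with
    | empty => exact ⟨fun _ => p, fun _ => hpq.2.1, hf.idem hF p, by simp⟩
    | insert a S _ ih =>
      obtain ⟨y, hy2, hy, hyS⟩ := ih
      by_cases ha : (∀ j, a j ≠ 2) ∧ f a = p
      · refine ⟨_, fun j => ?_, h y a hy2 ha.1 hy ha.2, ?_⟩
        · split_ifs
          exacts [hpq.2.2, ha.1 j]
        · intro z hz hz2 hzp i hi
          rcases Finset.mem_insert.1 hz with rfl | hz
          · simp [hi]
          · simp [hyS z hz hz2 hzp i hi]
      · refine ⟨y, hy2, hy, fun z hz hz2 hzp => ?_⟩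
        rcases Finset.mem_insert.1 hz with rfl | hz
        · exact absurd ⟨hz2, hzp⟩ ha
        · exact hyS z hz hz2 hzp
  obtain ⟨y, hy2, hy, hyS⟩ := key Finset.univ
  refine hnc (collapsible_of_dominating hF hpq hf y hy2 hy fun i hi => ?_)
  rcases hst.cases hpq i with hx | ⟨z, hz2, hz, hzi⟩
  · exact hx
  · exact absurd (hi.symm.trans (hyS z (Finset.mem_univ _) hz2 hz i hzi)) hpq.1

end Witnesses

/-- The operation `f` of the clone of the non-collapsible set `F` satisfies property (*). -/
structure IsWitness (F : Set Op) {n : ℕ} (f : (Fin n → D) → D) : Prop where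
  adm : Admissible F
  not_collapsible : ¬ Collapsible F
  mem : InClone F ⟨n, f⟩
  star : PropStar f

/-- Every operation of the clone that maps the rows `j ∈ R` of the matrix with columns `κ` to
`u j` maps `v` to `a`. -/
def Forces (F : Set Op) {m N : ℕ} (κ : Fin N → Fin m → D) (v : Fin N → D) (R : Finset (Fin m))
    (u : Fin m → D) (a : D) : Prop :=
  ∀ g : (Fin N → D) → D, InClone F ⟨N, g⟩ → (∀ j ∈ R, g (fun i => κ i j) = u j) → g v = a

/-- Every Boolean vector agrees on `R` with some column, and the columns are Boolean. -/
structure RichOn {m N : ℕ} (κ : Fin N → Fin m → D) (R : Finset (Fin m)) : Prop where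
  ne_two : ∀ i j, κ i j ≠ 2
  exists_column : ∀ u : Fin m → D, (∀ j, u j ≠ 2) → ∃ i, ∀ j ∈ R, κ i j = u j

section Forcing

variable {F : Set Op} {n m N : ℕ} {f : (Fin n → D) → D} {p q : D} {κ : Fin N → Fin m → D}
  {v : Fin N → D} {R : Finset (Fin m)} {u u' u₁ u₂ t : Fin m → D}

theorem Forces.column {a : D} (h : Forces F κ v R u a) {i : Fin N} (hi : ∀ j ∈ R, κ i j = u j) :
    v i = a :=
  h (fun z => z i) (.proj i) hi

theorem Forces.eq_of_forall (hW : IsWitness F f) (hpq : IsPair p q) (hκ : RichOn κ R)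
    (hu : ∀ j, u j ≠ 2) (h : Forces F κ v R u p) {i : Fin N}
    (hi : ∀ j ∈ R, u j = p → κ i j = p) : v i = p := by
  obtain ⟨i₀, hi₀⟩ := hκ.exists_column u hu
  have key : ∀ x, (∀ l, x l ≠ 2) → f x = q → f (fun l => if x l = q then p else v i) = p := by
    intro x hx2 hx
    have := h (fun z => f fun l => if x l = q then z i₀ else z i)
      (.comp f (fun l z => if x l = q then z i₀ else z i) hW.mem fun l => by
        by_cases hl : x l = q
        · simpa only [hl, if_true] using InClone.proj i₀
        · simpa only [hl, if_false] using InClone.proj i) fun j hj => ?_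
    · simpa only [h.column hi₀] using this
    · simp only [hi₀ j hj]
      have hid := hW.mem.idem hW.adm
      by_cases hup : u j = p
      · simpa only [hup, hi j hj hup, ite_self] using hid p
      · have huq := hpq.eq_of_ne (hu j) hup
        by_cases hip : κ i j = p
        · rw [huq, hip]
          refine Eq.trans (congrArg f (funext fun l => ?_)) hx
          split_ifs with hl
          · exact hl.symm
          · exact (hpq.symm.eq_of_ne (hx2 l) hl).symm
        · simpa only [huq, hpq.eq_of_ne (hκ.ne_two i j) hip, ite_self] using hid q
  rcases hpq.cases (v i) with hv | hv | hv
  · exact hv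
  · obtain ⟨c, hc⟩ := exists_coordinate hW.adm hW.not_collapsible hW.mem hpq.symm
    rcases hW.star.cases hpq c with ⟨x, hx2, hx, hxc⟩ | ⟨y, hy2, hy, hyc⟩
    · have := hc _ (fun j => ?_) (key x hx2 hx)
      · rw [hxc, if_neg hpq.1, hv] at this
        exact absurd this hpq.1.symm
      · split_ifs
        exacts [hpq.2.1, hv ▸ hpq.2.2]
    · exact absurd ((hc y hy2 hy).symm.trans hyc) hpq.1
  · obtain ⟨x, hx2, hx, hx'⟩ := exists_shifted hW.adm hW.not_collapsible hW.mem hW.star hpq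
    exact absurd (hv ▸ key x hx2 hx) hx'

theorem forces_or_of_ne_two (hF : Admissible F) (hpq : IsPair p q)
    (h : ∀ g : (Fin N → D) → D, InClone F ⟨N, g⟩ → (∀ j ∈ R, g (fun i => κ i j) = u j) → g v ≠ 2) :
    Forces F κ v R u p ∨ Forces F κ v R u q := by
  by_contra! hcon
  unfold Forces at hcon
  push Not at hcon
  obtain ⟨⟨g₁, hg₁, hR₁, hv₁⟩, g₂, hg₂, hR₂, hv₂⟩ := hcon
  refine h _ (hg₁.join hF hg₂) (fun j hj => by simp [hR₁ j hj, hR₂ j hj]) ?_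
  simp [hpq.eq_of_ne (h g₁ hg₁ hR₁) hv₁, hpq.symm.eq_of_ne (h g₂ hg₂ hR₂) hv₂, hpq.1.symm]

theorem Forces.forces_or (hW : IsWitness F f) (hpq : IsPair p q) (hκ : RichOn κ R)
    (hu : ∀ j, u j ≠ 2) (hu' : ∀ j, u' j ≠ 2) (h : Forces F κ v R u p)
    (huu' : ∀ j ∈ R, u j = q → u' j = q) : Forces F κ v R u' p ∨ Forces F κ v R u' q := by
  obtain ⟨i₀, hi₀⟩ := hκ.exists_column u hu
  obtain ⟨y, hy2, hy, hy'⟩ := exists_lowered hW.adm hW.not_collapsible hW.mem hW.star hpq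
  have key : ∀ g : (Fin N → D) → D, InClone F ⟨N, g⟩ → (∀ j ∈ R, g (fun i => κ i j) = u' j) →
      g v ≠ 2 := by
    intro g hg hgR hgv
    apply hy'
    have := h (fun z => f fun l => if y l = p then z i₀ else g z)
      (.comp f (fun l z => if y l = p then z i₀ else g z) hW.mem fun l => by
        by_cases hl : y l = p
        · simpa only [hl, if_true] using InClone.proj i₀
        · simpa only [hl, if_false] using hg) fun j hj => ?_
    · simpa only [h.column hi₀, hgv] using this
    · simp only [hi₀ j hj, hgR j hj]
      have hid := hW.mem.idem hW.adm
      by_cases huq : u j = q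
      · simpa only [huq, huu' j hj huq, ite_self] using hid q
      · have hup := hpq.symm.eq_of_ne (hu j) huq
        by_cases hup' : u' j = p
        · simpa only [hup, hup', ite_self] using hid p
        · rw [hup, hpq.eq_of_ne (hu' j) hup']
          refine Eq.trans (congrArg f (funext fun l => ?_)) hy
          split_ifs with hl
          · exact hl.symm
          · exact (hpq.eq_of_ne (hy2 l) hl).symm
  exact forces_or_of_ne_two hW.adm hpq key

theorem Forces.false_of_disjoint (hW : IsWitness F f) (hpq : IsPair p q) (hκ : RichOn κ R)
    (hu : ∀ j, u j ≠ 2) (hu₁ : ∀ j, u₁ j ≠ 2) (hu₂ : ∀ j, u₂ j ≠ 2) (h : Forces F κ v R u p)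
    (h₁ : Forces F κ v R u₁ q) (h₂ : Forces F κ v R u₂ q) (huu₁ : ∀ j ∈ R, u j = q → u₁ j = q)
    (huu₂ : ∀ j ∈ R, u j = q → u₂ j = q)
    (hdisj : ∀ j ∈ R, u₁ j = q → u₂ j = q → u j = q) : False := by
  obtain ⟨w, hw⟩ : ∃ w : Fin m → D, w = fun j => if u₁ j = q then q else u₂ j := ⟨_, rfl⟩
  have hw2 : ∀ j, w j ≠ 2 := by
    intro j
    rw [hw]
    dsimp only
    split_ifs
    exacts [hpq.2.2, hu₂ j]
  obtain ⟨i₀, hi₀⟩ := hκ.exists_column u hu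
  obtain ⟨i₁, hi₁⟩ := hκ.exists_column u₁ hu₁
  obtain ⟨i₂, hi₂⟩ := hκ.exists_column u₂ hu₂
  obtain ⟨i₃, hi₃⟩ := hκ.exists_column w hw2
  rcases h.forces_or hW hpq hκ hu hw2 (fun j hj huj => by simp [hw, huu₁ j hj huj]) with h₃ | h₃
  · have := h₁.eq_of_forall hW hpq.symm hκ hu₁ (i := i₃) fun j hj huj => by
      rw [hi₃ j hj, hw]
      simp [huj]
    exact hpq.1 ((h₃.column hi₃).symm.trans this)
  · obtain ⟨y, z, hy2, hz2, hy, hz, hyz⟩ :=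
      exists_union hW.adm hW.not_collapsible hW.mem hW.star hpq
    apply hyz
    have := h (fun x => f fun l => x (if y l = q then (if z l = q then i₃ else i₁) else
        (if z l = q then i₂ else i₀)))
      (.comp f (fun l x => x (if y l = q then (if z l = q then i₃ else i₁) else
        (if z l = q then i₂ else i₀))) hW.mem fun l => .proj _) fun j hj => ?_
    · rw [← this]
      congr 1
      funext l
      by_cases hyl : y l = q <;> by_cases hzl : z l = q
      · simp [hyl, hzl, h₃.column hi₃]
      · simp [hyl, hzl, h₁.column hi₁]
      · simp [hyl, hzl, h₂.column hi₂]
      · simpa [hyl, hzl, h.column hi₀] using hpq.symm.eq_of_ne (hz2 l) hzl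
    · have hid := hW.mem.idem hW.adm
      have e₀ := hi₀ j hj
      have e₁ := hi₁ j hj
      have e₂ := hi₂ j hj
      have e₃ := hi₃ j hj
      by_cases huq : u j = q
      · have e₃' : w j = q := by simp [hw, huu₁ j hj huq]
        rw [huu₁ j hj huq] at e₁
        rw [huu₂ j hj huq] at e₂
        rw [huq] at e₀ ⊢
        rw [e₃'] at e₃
        refine Eq.trans (congrArg f (funext fun l => ?_)) (hid q)
        split_ifs <;> assumption
      · have hup := hpq.symm.eq_of_ne (hu j) huq
        rw [hup] at e₀ ⊢
        by_cases hu₁q : u₁ j = q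
        · have hu₂p := hpq.symm.eq_of_ne (hu₂ j) fun h => huq (hdisj j hj hu₁q h)
          have e₃' : w j = q := by simp [hw, hu₁q]
          rw [hu₁q] at e₁
          rw [hu₂p] at e₂
          rw [e₃'] at e₃
          refine Eq.trans (congrArg f (funext fun l => ?_)) hy
          by_cases hyl : y l = q
          · rw [if_pos hyl, hyl]
            split_ifs <;> assumption
          · rw [if_neg hyl, hpq.symm.eq_of_ne (hy2 l) hyl]
            split_ifs <;> assumption
        · have hu₁p := hpq.symm.eq_of_ne (hu₁ j) hu₁q
          rw [hu₁p] at e₁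
          have e₃' : w j = u₂ j := by simp [hw, hu₁q]
          rw [e₃'] at e₃
          by_cases hu₂q : u₂ j = q
          · rw [hu₂q] at e₂ e₃
            refine Eq.trans (congrArg f (funext fun l => ?_)) hz
            by_cases hzl : z l = q
            · rw [if_pos hzl, if_pos hzl, hzl]
              split_ifs <;> assumption
            · rw [if_neg hzl, if_neg hzl, hpq.symm.eq_of_ne (hz2 l) hzl]
              split_ifs <;> assumption
          · rw [hpq.symm.eq_of_ne (hu₂ j) hu₂q] at e₂ e₃
            refine Eq.trans (congrArg f (funext fun l => ?_)) (hid p)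
            split_ifs <;> assumption

theorem Forces.eq_const_or_row (hW : IsWitness F f) (hpq : IsPair p q) (hκ : RichOn κ R)
    (ht : ∀ j, t j ≠ 2) (h : Forces F κ v R t p) :
    (∀ i, v i = p) ∨ ∃ l ∈ R, t l = p ∧ v = fun i => κ i l := by
  classical
  obtain ⟨U, hU⟩ : ∃ U : Finset (Fin m) → Fin m → D, U = fun T j => if j ∈ T then q else t j :=
    ⟨_, rfl⟩
  have hUmem : ∀ {T j}, j ∈ T → U T j = q := fun hj => by simp [hU, hj]
  have hUnot : ∀ {T j}, j ∉ T → U T j = t j := fun hj => by simp [hU, hj]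
  have hUt : ∀ {T j}, t j = q → U T j = q := fun {T j} hj => by simp [hU, hj]
  have hU2 : ∀ T j, U T j ≠ 2 := by
    intro T j
    by_cases hj : j ∈ T
    · rw [hUmem hj]
      exact hpq.2.2
    · rw [hUnot hj]
      exact ht j
  have hUp : ∀ {T j}, U T j = p → j ∉ T ∧ t j = p := fun {T j} hj =>
    have hn : j ∉ T := fun hm => hpq.1 (hj.symm.trans (hUmem hm))
    ⟨hn, (hUnot hn).symm.trans hj⟩
  have hUor : ∀ T, Forces F κ v R (U T) p ∨ Forces F κ v R (U T) q := fun T =>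
    h.forces_or hW hpq hκ ht (hU2 T) fun j _ hj => hUt hj
  obtain ⟨Z, hZ⟩ : ∃ Z : Finset (Fin m), Z = R.filter fun j => t j = p := ⟨_, rfl⟩
  obtain ⟨C, hC⟩ : ∃ C : Fin N → Finset (Fin m), C = fun i => Z.filter fun j => κ i j = q :=
    ⟨_, rfl⟩
  have hCZ : ∀ i, C i ⊆ Z := fun i => by
    rw [hC]
    exact Finset.filter_subset _ _
  have hCκ : ∀ i, ∀ j ∈ C i, κ i j = q := fun i j hj => by
    rw [hC] at hj
    exact (Finset.mem_filter.1 hj).2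
  have hUκ : ∀ i, ∀ j ∈ R, U (C i) j = p → κ i j = p := by
    intro i j hj hp
    obtain ⟨hn, htp⟩ := hUp hp
    refine hpq.symm.eq_of_ne (hκ.ne_two i j) fun hq => hn ?_
    simp [hC, hZ, hj, htp, hq]
  by_cases hall : ∀ T ⊆ Z, Forces F κ v R (U T) p
  · exact .inl fun i => (hall _ (hCZ i)).eq_of_forall hW hpq hκ (hU2 _) (hUκ i)
  right
  push Not at hall
  obtain ⟨T, ⟨hTZ, hT⟩, hTmin⟩ := (wellFounded_lt (α := Finset (Fin m))).has_min
    {T | T ⊆ Z ∧ ¬ Forces F κ v R (U T) p} hall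
  have hsmall : ∀ T', T' ⊂ T → Forces F κ v R (U T') p := by
    intro T' hT'
    by_contra hcon
    exact hTmin T' ⟨hT'.subset.trans hTZ, hcon⟩ hT'
  have hTq := (hUor T).resolve_left hT
  obtain ⟨l, hl⟩ : T.Nonempty := by
    rw [Finset.nonempty_iff_ne_empty]
    rintro rfl
    apply hT
    simpa [hU] using h
  have hTl : T = {l} := by
    by_contra hne
    refine hTq.false_of_disjoint hW hpq.symm hκ (hU2 T) (hU2 {l}) (hU2 (T.erase l))
      (hsmall _ ?_) (hsmall _ (Finset.erase_ssubset hl)) ?_ ?_ ?_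
    · exact Finset.ssubset_iff_subset_ne.2 ⟨by simpa using hl, Ne.symm hne⟩
    · intro j _ hj
      obtain ⟨hn, hp⟩ := hUp hj
      rw [hUnot, hp]
      rw [Finset.mem_singleton]
      rintro rfl
      exact hn hl
    · intro j _ hj
      obtain ⟨hn, hp⟩ := hUp hj
      rw [hUnot, hp]
      exact fun hm => hn (Finset.mem_of_mem_erase hm)
    · intro j _ hj₁ hj₂
      obtain ⟨hn₁, hp⟩ := hUp hj₁
      obtain ⟨hn₂, -⟩ := hUp hj₂
      rw [hUnot, hp]
      intro hm
      exact hn₂ (Finset.mem_erase.2 ⟨by simpa using hn₁, hm⟩)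
  subst hTl
  have hlZ := hTZ hl
  have hlR : l ∈ R ∧ t l = p := by simpa [hZ] using hlZ
  refine ⟨l, hlR.1, hlR.2, funext fun i => ?_⟩
  by_cases hil : κ i l = p
  · rw [hil]
    rcases hUor (C i) with hp | hq
    · exact hp.eq_of_forall hW hpq hκ (hU2 _) (hUκ i)
    · refine (h.false_of_disjoint hW hpq hκ ht (hU2 _) (hU2 _) hTq hq (fun j _ => hUt)
        (fun j _ => hUt) fun j _ hj₁ hj₂ => ?_).elim
      by_contra hne
      have hm₁ : j ∈ ({l} : Finset (Fin m)) := by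
        by_contra hm
        exact hne ((hUnot hm).symm.trans hj₁)
      have hm₂ : j ∈ C i := by
        by_contra hm
        exact hne ((hUnot hm).symm.trans hj₂)
      rw [Finset.mem_singleton] at hm₁
      subst hm₁
      exact hpq.1 (hil.symm.trans (hCκ i _ hm₂))
  · have hil := hpq.eq_of_ne (hκ.ne_two i l) hil
    have hlC : l ∈ C i := by simp [hC, hlZ, hil]
    rw [hil]
    rcases hUor (C i) with hp | hq
    · obtain ⟨i', hi'⟩ := hκ.exists_column (U (C i)) (hU2 _)
      have := hTq.eq_of_forall hW hpq.symm hκ (hU2 _) (i := i') fun j hj hjq => by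
        rw [hi' j hj]
        by_cases hm : j = l
        · exact hUmem (hm ▸ hlC)
        · exact hUt ((hUnot (by simpa using hm)).symm.trans hjq)
      exact absurd ((hp.column hi').symm.trans this) hpq.1
    · rcases hq.forces_or hW hpq.symm hκ (hU2 _) (hκ.ne_two i) (hUκ i) with hq' | hp'
      · exact hq'.column fun j _ => rfl
      · refine (hq.false_of_disjoint hW hpq.symm hκ (hU2 _) ht (hκ.ne_two i) h hp'
          (fun j _ hj => (hUp hj).2) (hUκ i) fun j _ hj₁ hj₂ => ?_).elim
        rw [hUnot, hj₁]
        exact fun hm => hpq.1 (hj₂.symm.trans (hCκ i j hm))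

theorem exists_eq_two (hW : IsWitness F f) (hκ : RichOn κ R) (ht : ∀ j, t j ≠ 2)
    (hconst : ∀ c, v ≠ fun _ => c) (hrow : ∀ j ∈ R, v ≠ fun i => κ i j) :
    ∃ g : (Fin N → D) → D, InClone F ⟨N, g⟩ ∧ (∀ j ∈ R, g (fun i => κ i j) = t j) ∧ g v = 2 := by
  by_contra! h
  have hpq : IsPair 0 1 := by
    unfold IsPair
    decide
  have key : ∀ p q, IsPair p q → ¬ Forces F κ v R t p := by
    intro p q hpq hv
    rcases hv.eq_const_or_row hW hpq hκ ht with h | ⟨l, hl, -, h⟩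
    · exact hconst p (funext h)
    · exact hrow l hl h
  rcases forces_or_of_ne_two hW.adm hpq h with h | h
  · exact key _ _ hpq h
  · exact key _ _ hpq.symm h

/-- An operation that maps row `j` to `t j` and all other non-constant vectors to `2` is
interpolated by the clone on few vectors. -/
theorem exists_interpolation (hW : IsWitness F f) {h : ℕ}
    (hκ : ∀ R : Finset (Fin m), R.card ≤ h → RichOn κ R) (ht : ∀ j, t j ≠ 2)
    {φ : (Fin N → D) → D} (hφ : Idem φ) (hφrow : ∀ j, φ (fun i => κ i j) = t j)
    (hφ2 : ∀ x, (∀ c, x ≠ fun _ => c) → (∀ j, x ≠ fun i => κ i j) → φ x = 2)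
    {k : ℕ} (hk : k ≤ h) (V : Fin k → Fin N → D) :
    ∃ g : (Fin N → D) → D, InClone F ⟨N, g⟩ ∧ ∀ a, g (V a) = φ (V a) := by
  classical
  have hJ : ∀ a, ∃ s : Finset (Fin m), s.card ≤ 1 ∧
      ((∃ j, V a = fun i => κ i j) → ∃ j ∈ s, V a = fun i => κ i j) := by
    intro a
    by_cases ha : ∃ j, V a = fun i => κ i j
    · obtain ⟨j, hj⟩ := ha
      exact ⟨{j}, by simp, fun _ => ⟨j, by simp, hj⟩⟩
    · exact ⟨∅, by simp, fun h => absurd h ha⟩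
  choose J hJ1 hJ using hJ
  obtain ⟨R, hR⟩ : ∃ R : Finset (Fin m), R = Finset.univ.biUnion J := ⟨_, rfl⟩
  have hJR : ∀ a, J a ⊆ R := fun a => by
    rw [hR]
    exact Finset.subset_biUnion_of_mem J (Finset.mem_univ a)
  have hRcard : R.card ≤ h := by
    rw [hR]
    refine (Finset.card_biUnion_le_card_mul _ _ 1 fun a _ => hJ1 a).trans ?_
    simpa using hk
  have hκR := hκ R hRcard
  have key : ∀ S : Finset (Fin k), ∃ g : (Fin N → D) → D, InClone F ⟨N, g⟩ ∧
      (∀ j ∈ R, g (fun i => κ i j) = t j) ∧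
      ∀ a ∈ S, (∀ c, V a ≠ fun _ => c) → (∀ j, V a ≠ fun i => κ i j) → g (V a) = 2 := by
    intro S
    induction S using Finset.induction_on with
    | empty =>
      obtain ⟨i, hi⟩ := hκR.exists_column t ht
      exact ⟨fun x => x i, .proj i, hi, by simp⟩
    | insert a S _ ih =>
      obtain ⟨g, hg, hgR, hgS⟩ := ih
      by_cases ha : (∀ c, V a ≠ fun _ => c) ∧ ∀ j, V a ≠ fun i => κ i j
      · obtain ⟨g', hg', hgR', hga⟩ := exists_eq_two hW hκR ht ha.1 fun j _ => ha.2 j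
        refine ⟨_, hg.join hW.adm hg', fun j hj => by simp [hgR j hj, hgR' j hj], ?_⟩
        intro b hb hc hr
        rcases Finset.mem_insert.1 hb with rfl | hb
        · simp [hga]
        · simp [hgS b hb hc hr]
      · refine ⟨g, hg, hgR, fun b hb hc hr => ?_⟩
        rcases Finset.mem_insert.1 hb with rfl | hb
        · exact absurd ⟨hc, hr⟩ ha
        · exact hgS b hb hc hr
  obtain ⟨g, hg, hgR, hg2⟩ := key Finset.univ
  refine ⟨g, hg, fun a => ?_⟩
  by_cases hc : ∃ c, V a = fun _ => c
  · obtain ⟨c, hc⟩ := hc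
    rw [hc, hφ c]
    exact hg.idem hW.adm c
  by_cases hr : ∃ j, V a = fun i => κ i j
  · obtain ⟨j, hj, hr⟩ := hJ a hr
    rw [hr, hφrow, hgR j (hJR a hj)]
  · push Not at hc hr
    rw [hg2 a (Finset.mem_univ _) hc hr, hφ2 _ hc hr]

theorem exists_row_operation (hκ : ∀ R : Finset (Fin m), R.card ≤ 2 → RichOn κ R)
    (ht : ∀ j, t j ≠ 2) : ∃ φ : (Fin N → D) → D, Idem φ ∧ (∀ j, φ (fun i => κ i j) = t j) ∧
      ∀ x, (∀ c, x ≠ fun _ => c) → (∀ j, x ≠ fun i => κ i j) → φ x = 2 := by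
  classical
  obtain ⟨i, -⟩ := (hκ ∅ (by simp)).exists_column t ht
  have hnc : ∀ j c, (fun i => κ i j) ≠ fun _ => c := by
    intro j c hc
    have hR := hκ {j} (by simp)
    obtain ⟨i₀, hi₀⟩ := hR.exists_column (fun _ => 0) (fun _ => by decide)
    obtain ⟨i₁, hi₁⟩ := hR.exists_column (fun _ => 1) (fun _ => by decide)
    have h := (congrFun hc i₀).trans (congrFun hc i₁).symm
    simp only [hi₀ j (by simp), hi₁ j (by simp)] at h
    exact absurd h (by decide)
  have hinj : ∀ j j', (fun i => κ i j) = (fun i => κ i j') → t j = t j' := by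
    intro j j' h
    obtain ⟨i, hi⟩ := (hκ {j, j'} Finset.card_le_two).exists_column t ht
    rw [← hi j (by simp), ← hi j' (by simp)]
    exact congrFun h i
  refine ⟨fun x => if h : ∃ c, x = fun _ => c then h.choose else
    if h : ∃ j, x = fun i => κ i j then t h.choose else 2, fun c => ?_, fun j => ?_,
    fun x hc hr => ?_⟩
  · have h : ∃ c', (fun _ : Fin N => c) = fun _ => c' := ⟨c, rfl⟩
    refine (dif_pos h).trans ?_
    exact (congrFun h.choose_spec i).symm
  · have h : ∃ j', (fun i => κ i j) = fun i => κ i j' := ⟨j, rfl⟩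
    refine (dif_neg fun ⟨c, hc⟩ => hnc j c hc).trans ((dif_pos h).trans ?_)
    exact (hinj _ _ h.choose_spec).symm
  · exact (dif_neg fun ⟨c, h⟩ => hc c h).trans (dif_neg fun ⟨j, h⟩ => hr j h)

theorem exists_columns (m k : ℕ) : ∃ (N : ℕ) (κ : Fin N → Fin m → D), (∀ i, κ i ∈ Lam m k) ∧
    ∀ R : Finset (Fin m), R.card ≤ k → RichOn κ R := by
  classical
  obtain ⟨N, ⟨e⟩⟩ := Finite.exists_equiv_fin {x : Fin m → D // (∀ j, x j ≠ 2) ∧ x ∈ Lam m k}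
  refine ⟨N, fun i => (e.symm i).1, fun i => (e.symm i).2.2, fun R hR =>
    ⟨fun i => (e.symm i).2.1, fun u hu => ?_⟩⟩
  refine ⟨e ⟨fun j => if j ∈ R then u j else 0, fun j => ?_, ?_⟩, fun j hj => by simp [hj]⟩
  · dsimp only
    split_ifs
    exacts [hu j, by decide]
  · refine mem_Lam_of_card 0 ((Finset.card_le_card fun j hj => ?_).trans hR)
    by_contra hn
    simp [hn] at hj

end Forcing

theorem statement15 (F : Set Op) (hgap : GapAlgebra F)
    (hproj : ∃ g ∈ F, ¬ Proj0212 g.2)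
    (Δ : Set RelD) (hfin : Δ.Finite) (hsub : ∀ ρ ∈ Δ, InInv F ρ.2) :
    Collapsible (PolSet Δ) := by
  obtain ⟨⟨n₀, f₀⟩, hf₀, hnp⟩ := hproj
  have hF : Admissible F := ⟨hgap.1, hgap.2.1⟩
  obtain ⟨n, f, hf, hst⟩ := exists_propStar hF hgap.2.2 (.base hf₀) hnp
  have hW : IsWitness F f := ⟨hF, hgap.2.2, hf, hst⟩
  obtain ⟨h, hh⟩ := (hfin.image Sigma.fst).bddAbove
  refine collapsible_of_bool (k := h + 2) (fun ρ hρ => hsub ρ hρ _ hF.1) fun m t ht => ?_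
  obtain ⟨N, κ, hκL, hκ⟩ := exists_columns m (h + 2)
  obtain ⟨φ, hφ, hφrow, hφ2⟩ := exists_row_operation (fun R hR => hκ R (by omega)) ht
  have hφΔ : (⟨N, φ⟩ : Op) ∈ PolSet Δ := by
    rintro ⟨k, ρ⟩ hρ T hT
    obtain ⟨g, hg, hgφ⟩ := exists_interpolation hW (h := h) (fun R hR => hκ R (by omega)) ht hφ
      hφrow hφ2 (hh ⟨_, hρ, rfl⟩) fun j i => T i j
    simpa only [hgφ] using hg.preservesRel (hsub _ hρ) T hT
  convert InClosure.app φ κ (.base hφΔ) fun i => .base (hκL i) using 1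
  funext j
  exact (hφrow j).symm
end

section
/- Let F be a set of idempotent operations on D = {0,1,2} such that every operation of F preserves {0,1} and acts as a projection on {0,1} (for each n-ary f ∈ F there is i with f(x_1,…,x_n) = x_i whenever all x_j ∈ {0,1}), and such that for each of the three pairs (α,β) ∈ {({0,2},{1,2}), ({0,1},{1,2}), ({0,1},{0,2})}, some operation of the clone generated by F is not αβ-projective. Then the clone generated by F contains ternary operations f, g, h, each acting as the first projection on {0,1} (returning its first argument whenever all three arguments lie in {0,1}), such that: f satisfies at least one of f(0,1,2)=1, f(1,0,2)=0, f(2,0,1)=1, f(2,0,1)=0; g satisfies at least one of g(1,0,2)=0, g(1,0,2)=2, g(0,1,2)=2, g(2,0,1)=0; and h satisfies at least one of h(0,1,2)=1, h(0,1,2)=2, h(1,0,2)=2, h(2,0,1)=1. -/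
/-- An operation is αβ-projective. -/
def ABProj (α β : Set D) {n : ℕ} (g : (Fin n → D) → D) : Prop :=
  ∃ i : Fin n, ∀ x : Fin n → D, (x i ∈ α → g x ∈ α) ∧ (x i ∈ β → g x ∈ β)

/-- Acting as a projection on `{0,1}` is inherited by the whole generated clone. -/
theorem InClone.exists_coord {F : Set Op}
    (hF : ∀ g ∈ F, ∃ i : Fin g.1, ∀ x : Fin g.1 → D, Bool01 x → g.2 x = x i)
    {o : Op} (ho : InClone F o) :
    ∃ i : Fin o.1, ∀ x : Fin o.1 → D, Bool01 x → o.2 x = x i := by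
  induction ho with
  | base hg => exact hF _ hg
  | proj i => exact ⟨i, fun _ _ => rfl⟩
  | comp f g _ _ ihf ihg =>
    obtain ⟨i, hi⟩ := ihf
    choose k hk using ihg
    refine ⟨k i, fun x hx => ?_⟩
    have hgx : Bool01 fun j => g j x := fun j =>
      (hx (k j)).imp (hk j x hx).trans (hk j x hx).trans
    exact (hi _ hgx).trans (hk i x hx)

/-- Identifying variables according to the values of `x` turns an operation of the clone into a
ternary one which takes the value `g x` at the tuple `y`. -/
theorem InClone.exists_ternary {F : Set Op} {n : ℕ} {g : (Fin n → D) → D}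
    (hg : InClone F ⟨n, g⟩) {i : Fin n} (hi : ∀ x, Bool01 x → g x = x i) (x : Fin n → D)
    (y : Fin 3 → D) (c : D → Fin 3) (hyc : ∀ d, y (c d) = d) (hc : c (x i) = 0) :
    ∃ f : (Fin 3 → D) → D, InClone F ⟨3, f⟩ ∧
      (∀ z, Bool01 z → f z = z 0) ∧ f y = g x := by
  refine ⟨fun z => g fun j => z (c (x j)),
    .comp g (fun j z => z (c (x j))) hg fun j => .proj (c (x j)), fun z hz => ?_, ?_⟩
  · exact (hi _ fun j => hz _).trans (congrArg z hc)
  · simp only [hyc]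

/-- A value `v` taken by an operation of the clone, at a tuple whose entry in the coordinate the
operation projects to on `{0,1}` is `a`, is taken by a ternary operation at a tuple starting
with `a`. -/
theorem InClone.exists_ternary_of_value {F : Set Op} {n : ℕ} {g : (Fin n → D) → D}
    (hg : InClone F ⟨n, g⟩) {i : Fin n} (hi : ∀ x, Bool01 x → g x = x i) (x : Fin n → D) :
    ∃ f : (Fin 3 → D) → D, InClone F ⟨3, f⟩ ∧ (∀ z, Bool01 z → f z = z 0) ∧
      (x i = 0 → f ![0, 1, 2] = g x) ∧ (x i = 1 → f ![1, 0, 2] = g x) ∧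
      (x i = 2 → f ![2, 0, 1] = g x) := by
  obtain h | h | h : x i = 0 ∨ x i = 1 ∨ x i = 2 := by
    generalize x i = a
    revert a
    decide
  · obtain ⟨f, hf, hf0, hfx⟩ := hg.exists_ternary hi x ![0, 1, 2] ![0, 1, 2] (by decide)
      (by rw [h]; rfl)
    exact ⟨f, hf, hf0, by simp [h, hfx]⟩
  · obtain ⟨f, hf, hf0, hfx⟩ := hg.exists_ternary hi x ![1, 0, 2] ![1, 0, 2] (by decide)
      (by rw [h]; rfl)
    exact ⟨f, hf, hf0, by simp [h, hfx]⟩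
  · obtain ⟨f, hf, hf0, hfx⟩ := hg.exists_ternary hi x ![2, 0, 1] ![1, 2, 0] (by decide)
      (by rw [h]; rfl)
    exact ⟨f, hf, hf0, by simp [h, hfx]⟩

/-- If some operation of the clone is not `αβ`-projective, then failure of `αβ`-projectivity is
witnessed by a ternary operation of the clone that is the first projection on `{0,1}`. -/
theorem exists_ternary_of_not_abProj {F : Set Op}
    (hF : ∀ g ∈ F, ∃ i : Fin g.1, ∀ x : Fin g.1 → D, Bool01 x → g.2 x = x i) {α β : Set D}
    (h : ∃ (n : ℕ) (g : (Fin n → D) → D), InClone F ⟨n, g⟩ ∧ ¬ ABProj α β g) :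
    ∃ f : (Fin 3 → D) → D, InClone F ⟨3, f⟩ ∧ (∀ z, Bool01 z → f z = z 0) ∧
      ∃ a v : D, ((a ∈ α ∧ v ∉ α) ∨ (a ∈ β ∧ v ∉ β)) ∧
        (a = 0 → f ![0, 1, 2] = v) ∧ (a = 1 → f ![1, 0, 2] = v) ∧
        (a = 2 → f ![2, 0, 1] = v) := by
  obtain ⟨n, g, hg, hng⟩ := h
  obtain ⟨i, hi⟩ := hg.exists_coord hF
  obtain ⟨x, hx⟩ := not_forall.1 (not_exists.1 hng i)
  obtain ⟨f, hf, hf0, hfx⟩ := hg.exists_ternary_of_value hi x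
  exact ⟨f, hf, hf0, x i, g x, by tauto, hfx⟩

theorem statement16 (F : Set Op)
    (hidem : ∀ g ∈ F, Idem g.2)
    (hpres : ∀ g ∈ F, PreservesSet g.2 {0, 1})
    (hproj01 : ∀ g ∈ F, ∃ i : Fin g.1, ∀ x : Fin g.1 → D, Bool01 x → g.2 x = x i)
    (hp1 : ∃ (n : ℕ) (g : (Fin n → D) → D), InClone F ⟨n, g⟩ ∧
      ¬ ABProj {0, 2} {1, 2} g)
    (hp2 : ∃ (n : ℕ) (g : (Fin n → D) → D), InClone F ⟨n, g⟩ ∧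
      ¬ ABProj {0, 1} {1, 2} g)
    (hp3 : ∃ (n : ℕ) (g : (Fin n → D) → D), InClone F ⟨n, g⟩ ∧
      ¬ ABProj {0, 1} {0, 2} g) :
    ∃ f g h : (Fin 3 → D) → D,
      InClone F ⟨3, f⟩ ∧ InClone F ⟨3, g⟩ ∧ InClone F ⟨3, h⟩ ∧
      (∀ x : Fin 3 → D, Bool01 x → f x = x 0) ∧
      (∀ x : Fin 3 → D, Bool01 x → g x = x 0) ∧
      (∀ x : Fin 3 → D, Bool01 x → h x = x 0) ∧
      (f ![0, 1, 2] = 1 ∨ f ![1, 0, 2] = 0 ∨ f ![2, 0, 1] = 1 ∨ f ![2, 0, 1] = 0) ∧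
      (g ![1, 0, 2] = 0 ∨ g ![1, 0, 2] = 2 ∨ g ![0, 1, 2] = 2 ∨ g ![2, 0, 1] = 0) ∧
      (h ![0, 1, 2] = 1 ∨ h ![0, 1, 2] = 2 ∨ h ![1, 0, 2] = 2 ∨ h ![2, 0, 1] = 1) := by
  obtain ⟨f, hf, hf0, a, v, hav, hfv⟩ := exists_ternary_of_not_abProj hproj01 hp1
  obtain ⟨g, hg, hg0, b, w, hbw, hgw⟩ := exists_ternary_of_not_abProj hproj01 hp2
  obtain ⟨h, hh, hh0, c, u, hcu, hhu⟩ := exists_ternary_of_not_abProj hproj01 hp3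
  refine ⟨f, g, h, hf, hg, hh, hf0, hg0, hh0, ?_, ?_, ?_⟩
  · clear * - hav hfv
    fin_cases a <;> fin_cases v <;> simp_all
  · clear * - hbw hgw
    fin_cases b <;> fin_cases w <;> simp_all
  · clear * - hcu hhu
    fin_cases c <;> fin_cases u <;> simp_all
end

section
/- Let r be a 5-ary idempotent operation on D = {0,1,2} such that r(x_1,…,x_5) = x_1 whenever x_1,…,x_5 ∈ {0,1}, and such that r(0,0,1,1,2) = 2 and r(0,1,0,1,2) = 1. Then the set {r} is 4-collapsible: for every m ≥ 1, every tuple of D^m lies in the closure of the set {x ∈ D^m : at least m−4 of the coordinates of x are equal} under coordinatewise applications of r. -/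
/-- Closure of a set `S ⊆ D^m` under coordinatewise applications of a single
n-ary operation `g`. -/
inductive ClosureOp {n m : ℕ} (g : (Fin n → D) → D) (S : Set (Fin m → D)) :
    (Fin m → D) → Prop
  | base {t : Fin m → D} : t ∈ S → ClosureOp g S t
  | app (ts : Fin n → Fin m → D) : (∀ i, ClosureOp g S (ts i)) →
      ClosureOp g S (fun j => g (fun i => ts i j))

theorem mem_Lam_of_eq_off {m : ℕ} {x : Fin m → D} (a : D) (b : Fin m)
    (h : ∀ i, i ≠ b → x i = a) : x ∈ Lam m 4 := by
  refine ⟨a, ?_⟩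
  have hsub : ({b}ᶜ : Set (Fin m)) ⊆ {i : Fin m | x i = a} := fun i hi => h i hi
  have hle := Set.ncard_le_ncard hsub
  have hcard : ({b}ᶜ : Set (Fin m)).ncard = m - 1 := by
    rw [Set.ncard_compl, Set.ncard_singleton, Nat.card_eq_fintype_card, Fintype.card_fin]
  omega

theorem ClosureOp.of_rows {m : ℕ} {r : (Fin 5 → D) → D} {S : Set (Fin m → D)}
    {a b c d e t : Fin m → D} (ha : ClosureOp r S a) (hb : ClosureOp r S b)
    (hc : ClosureOp r S c) (hd : ClosureOp r S d) (he : ClosureOp r S e)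
    (ht : ∀ j, r ![a j, b j, c j, d j, e j] = t j) : ClosureOp r S t := by
  have key := ClosureOp.app (g := r) (S := S) ![a, b, c, d, e] (by
    intro i
    fin_cases i <;> assumption)
  convert key using 1
  funext j
  rw [← ht j]
  congr 1
  funext i
  fin_cases i <;> rfl

theorem closureOp_indicator {m : ℕ} {r : (Fin 5 → D) → D}
    (hproj : ∀ x : Fin 5 → D, Bool01 x → r x = x 0) (h2 : r ![0, 1, 0, 1, 2] = 1)
    (b₀ : Fin m) (s : Finset (Fin m)) :
    ClosureOp r (Lam m 4) (fun j => if j ∈ s then 1 else 0) := by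
  induction s using Finset.induction_on with
  | empty => exact .base (mem_Lam_of_eq_off 0 b₀ (by simp))
  | insert b s hb ih =>
    refine .of_rows ih
      (b := fun j => if j = b then 1 else 0) (c := fun _ => 0) (d := fun _ => 1)
      (e := fun j => if j = b then 2 else 0)
      (.base (mem_Lam_of_eq_off 0 b ?_)) (.base (mem_Lam_of_eq_off 0 b ?_))
      (.base (mem_Lam_of_eq_off 1 b ?_)) (.base (mem_Lam_of_eq_off 0 b ?_)) ?_
    · intro i hi; simp [hi]
    · intro i _; rfl
    · intro i _; rfl
    · intro i hi; simp [hi]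
    · intro j
      by_cases hj : j = b
      · subst hj; simpa [hb] using h2
      · by_cases hs : j ∈ s
        · simpa [hj, hs] using hproj ![1, 0, 0, 1, 0] (by unfold Bool01; decide)
        · simpa [hj, hs] using hproj ![0, 0, 0, 1, 0] (by unfold Bool01; decide)

theorem statement17 (r : (Fin 5 → D) → D) (hidem : Idem r)
    (hproj : ∀ x : Fin 5 → D, Bool01 x → r x = x 0)
    (h1 : r ![0, 0, 1, 1, 2] = 2) (h2 : r ![0, 1, 0, 1, 2] = 1) :
    ∀ m : ℕ, 1 ≤ m → ∀ t : Fin m → D, ClosureOp r (Lam m 4) t := by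
  intro m hm t
  have b₀ : Fin m := ⟨0, hm⟩
  have hconst (a : D) : ClosureOp r (Lam m 4) (fun _ => a) :=
    .base (mem_Lam_of_eq_off a b₀ fun _ _ => rfl)
  have hind (p : Fin m → Prop) [DecidablePred p] :
      ClosureOp r (Lam m 4) (fun j => if p j then 1 else 0) := by
    simpa using closureOp_indicator hproj h2 b₀ (Finset.univ.filter p)
  have htwo : ClosureOp r (Lam m 4) (fun j => if t j = 2 then 2 else 1) := by
    refine .of_rows (hconst 0) (hind fun j => t j ≠ 2) (hind fun j => t j = 2)
      (hconst 1) (hconst 2) fun j => ?_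
    by_cases hj : t j = 2
    · simpa [hj] using h1
    · simpa [hj] using h2
  refine .of_rows (hind fun j => t j = 1) (hconst 0) (hconst 1) (hconst 1) htwo fun j => ?_
  have hcases : ∀ x : D, x = 0 ∨ x = 1 ∨ x = 2 := by decide
  rcases hcases (t j) with hj | hj | hj
  · simpa [hj] using hproj ![0, 0, 1, 1, 1] (by unfold Bool01; decide)
  · simpa [hj] using hproj ![1, 0, 1, 1, 1] (by unfold Bool01; decide)
  · simpa [hj] using h1
end

section
/- Let F be a set of idempotent operations on D = {0,1,2}. If F is switchable, then for every finite subset Δ of Inv(F), the clone Pol(Δ) is collapsible. -/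
/-- Tuples of `D^m` with at most `k` switches. -/
def SwitchSet (m k : ℕ) : Set (Fin m → D) :=
  {x | Set.ncard {i : Fin m | ∃ h : i.1 + 1 < m, x i ≠ x ⟨i.1 + 1, h⟩} ≤ k}

/-- `F` is `k`-switchable. -/
def KSwitchable (F : Set Op) (k : ℕ) : Prop :=
  ∀ m : ℕ, 1 ≤ m → ∀ t : Fin m → D, InClosure F (SwitchSet m k) t

/-- `F` is switchable: `k`-switchable for some `k`. -/
def Switchable (F : Set Op) : Prop := ∃ k, KSwitchable F k

/-- `f` is an idempotent polymorphism of `Δ`, with arguments indexed by an arbitrary type. -/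
def IsTerm (Δ : Set RelD) {ι : Type} (f : (ι → D) → D) : Prop :=
  (∀ a, f (fun _ => a) = a) ∧
  ∀ ρ ∈ Δ, ∀ t : ι → Fin ρ.1 → D, (∀ i, t i ∈ ρ.2) → (fun j => f fun i => t i j) ∈ ρ.2

/-- The value of `f` can lie in `S` only when the `i`-th argument does. -/
def Controls {ι : Type} (f : (ι → D) → D) (S : Set D) (i : ι) : Prop :=
  ∀ x, f x ∈ S → x i ∈ S

/-- Every idempotent polymorphism of `Δ` has a coordinate controlling `S`. -/
def Controlled (Δ : Set RelD) (S : Set D) : Prop :=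
  ∀ (ι : Type) [Fintype ι] (f : (ι → D) → D), IsTerm Δ f → ∃ i, Controls f S i

/-- Some idempotent polymorphism of `Δ` has no coordinate controlling both `S₀` and `S₁`. -/
def NonProj (Δ : Set RelD) (S₀ S₁ : Set D) : Prop :=
  ∃ (n : ℕ) (f : (Fin n → D) → D), IsTerm Δ f ∧ ∀ i, Controls f S₀ i → ¬ Controls f S₁ i

/-- The tuples generated from `Lam m k` by the polymorphisms of `Δ`. -/
abbrev Gen (Δ : Set RelD) (k : ℕ) {m : ℕ} (t : Fin m → D) : Prop :=
  InClosure (PolSet Δ) (Lam m k) t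

section Terms

variable {Δ : Set RelD}

theorem isTerm_proj {ι : Type} (i : ι) : IsTerm Δ (fun x : ι → D => x i) :=
  ⟨fun _ => rfl, fun _ _ _ ht => ht i⟩

theorem IsTerm.comp {ι κ : Type} {f : (ι → D) → D} {g : ι → (κ → D) → D}
    (hf : IsTerm Δ f) (hg : ∀ i, IsTerm Δ (g i)) : IsTerm Δ (fun x => f fun i => g i x) := by
  refine ⟨fun a => ?_, fun ρ hρ t ht => ?_⟩
  · simp only [(hg _).1, hf.1]
  · exact hf.2 ρ hρ (fun i j => g i fun k => t k j) fun i => (hg i).2 ρ hρ t ht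

theorem IsTerm.reindex {ι κ : Type} {f : (ι → D) → D} (hf : IsTerm Δ f) (e : ι → κ) :
    IsTerm Δ (fun x : κ → D => f fun i => x (e i)) :=
  hf.comp fun i => isTerm_proj (e i)

theorem isTerm_of_inClone {F : Set Op} (hidem : ∀ g ∈ F, Idem g.2)
    (hsub : ∀ ρ ∈ Δ, InInv F ρ.2) {g : Op} (hg : InClone F g) : IsTerm Δ g.2 := by
  induction hg with
  | base h => exact ⟨fun a => hidem _ h a, fun ρ hρ => hsub ρ hρ _ h⟩
  | proj i => exact isTerm_proj i
  | comp f g _ _ ihf ihg => exact IsTerm.comp (f := f) (g := g) ihf ihg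

theorem Gen.app {k m : ℕ} {ι : Type} [Fintype ι] {f : (ι → D) → D} (hf : IsTerm Δ f)
    {ts : ι → Fin m → D} (hts : ∀ i, Gen Δ k (ts i)) : Gen Δ k (fun d => f fun i => ts i d) := by
  have h := InClosure.app (F := PolSet Δ) (S := Lam m k)
    (fun x : Fin (Fintype.card ι) → D => f fun i => x (Fintype.equivFin ι i))
    (fun i => ts ((Fintype.equivFin ι).symm i))
    (.base fun ρ hρ => (hf.reindex (Fintype.equivFin ι)).2 ρ hρ) (fun i => hts _)
  simpa using h

/-- Generating a tuple from a family of rows: row `d` evaluates to `t d`, and every column is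
generated. -/
theorem Gen.of_rows {k m : ℕ} {ι : Type} [Fintype ι] {f : (ι → D) → D} (hf : IsTerm Δ f)
    {t : Fin m → D} (R : Fin m → ι → D) (hR : ∀ d, f (R d) = t d)
    (hcol : ∀ i, Gen Δ k fun d => R d i) : Gen Δ k t := by
  have h := Gen.app hf hcol
  simpa only [hR] using h

theorem Gen.of_eq_off {k m : ℕ} {t : Fin m → D} (a : D) (W : Finset (Fin m)) (hW : W.card ≤ k)
    (h : ∀ d, d ∉ W → t d = a) : Gen Δ k t := by
  refine .base ⟨a, ?_⟩
  have h1 : ((Wᶜ : Finset (Fin m)) : Set (Fin m)) ⊆ {i | t i = a} := by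
    intro d hd
    exact h d (by simpa using hd)
  have h2 := Set.ncard_le_ncard h1 (Set.toFinite _)
  rw [Set.ncard_coe_finset, Finset.card_compl, Fintype.card_fin] at h2
  omega

theorem exists_injective_into {ι : Type} [Fintype ι] {m : ℕ} (O : Finset (Fin m))
    (h : Fintype.card ι ≤ O.card) : ∃ e : ι → Fin m, Function.Injective e ∧ ∀ i, e i ∈ O := by
  have h' : Fintype.card ι ≤ Fintype.card O := by simpa using h
  obtain ⟨e⟩ := Function.Embedding.nonempty_of_card_le h'
  exact ⟨fun i => e i, fun i j hij => e.injective (Subtype.ext hij), fun i => (e i).2⟩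

/-- An idempotent polymorphism that stays surjective after fixing any one argument to `a`
witnesses collapsibility. -/
theorem collapsible_of_surjective {ι : Type} [Fintype ι] {f : (ι → D) → D} (hf : IsTerm Δ f)
    (a : D) (h : ∀ i y, ∃ x, x i = a ∧ f x = y) : Collapsible (PolSet Δ) := by
  classical
  choose w hwa hwf using h
  refine ⟨Fintype.card ι, fun m _ => ?_⟩
  suffices H : ∀ (O : Finset (Fin m)) (t : Fin m → D), (∀ d, d ∉ O → t d = a) →
      Gen Δ (Fintype.card ι) t from
    fun t => H Finset.univ t fun d hd => absurd (Finset.mem_univ d) hd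
  intro O
  induction O using Finset.strongInduction with
  | H O ih =>
    intro t ht
    rcases Nat.le_total O.card (Fintype.card ι) with hc | hc
    · exact Gen.of_eq_off a O hc ht
    obtain ⟨e, he, heO⟩ := exists_injective_into O hc
    refine Gen.of_rows hf (fun d => if hd : ∃ i, e i = d then w hd.choose (t d) else fun _ => t d)
      (fun d => ?_) (fun i => ?_)
    · split_ifs with hd
      · exact hwf _ _
      · exact hf.1 _
    · refine ih (O.erase (e i)) (Finset.erase_ssubset (heO i)) _ fun d hd => ?_
      by_cases hdi : d = e i
      · subst hdi
        have hx : ∃ j, e j = e i := ⟨i, rfl⟩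
        have hji : hx.choose = i := he hx.choose_spec
        rw [dif_pos hx]
        rw [hji, hwa]
      · have hdO : d ∉ O := fun h' => hd (Finset.mem_erase.2 ⟨hdi, h'⟩)
        have hx : ¬ ∃ j, e j = d := by
          rintro ⟨j, rfl⟩
          exact hdO (heO j)
        rw [dif_neg hx]
        exact ht d hdO

/-- Values reachable in a composition with disjoint variables. -/
theorem exists_row_prod {ι κ : Type} {f : (ι → D) → D} {g : (κ → D) → D}
    (hg : IsTerm Δ g) {a y z : D} {i : ι} {j : κ} (h₁ : ∃ x, x j = a ∧ g x = z)
    (h₂ : ∃ x, x i = z ∧ f x = y) :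
    ∃ x : ι × κ → D, x (i, j) = a ∧ f (fun i' => g fun j' => x (i', j')) = y := by
  classical
  obtain ⟨p, hp, hpz⟩ := h₁
  obtain ⟨q, hq, hqy⟩ := h₂
  refine ⟨fun c => if c.1 = i then p c.2 else q c.1, by simpa using hp, ?_⟩
  rw [← hqy]
  congr 1
  funext i'
  by_cases hi : i' = i
  · subst hi
    simp [hpz, hq]
  · simp [hi, hg.1]

theorem IsTerm.prod {ι κ : Type} {f : (ι → D) → D} {g : (κ → D) → D} (hf : IsTerm Δ f)
    (hg : IsTerm Δ g) : IsTerm Δ (fun x : ι × κ → D => f fun i => g fun j => x (i, j)) :=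
  hf.comp fun i => hg.reindex fun j => (i, j)

theorem exists_controlled (hnc : ¬ Collapsible (PolSet Δ)) {a b c : D}
    (hD : ∀ x : D, x = a ∨ x = b ∨ x = c) :
    Controlled Δ {b} ∨ Controlled Δ {c} ∨ Controlled Δ {b, c} := by
  by_contra hcon
  simp only [not_or, Controlled, not_forall, Controls, not_exists, Set.mem_singleton_iff,
    Set.mem_insert_iff, exists_prop] at hcon
  obtain ⟨⟨ι₂, _, f₂, hf₂, h₂⟩, ⟨ι₃, _, f₃, hf₃, h₃⟩, ι₁, _, f₁, hf₁, h₁⟩ := hcon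
  apply hnc
  have ha : ∀ i, ∃ x, x i = a ∧ f₁ x = a := fun i => ⟨fun _ => a, rfl, hf₁.1 a⟩
  have hb : ∀ p : ι₂ × ι₁, ∃ x : ι₂ × ι₁ → D, x p = a ∧
      f₂ (fun i => f₁ fun j => x (i, j)) = b := by
    rintro ⟨i, j⟩
    obtain ⟨x, hx, hxj⟩ := h₁ j
    have hxa : x j = a := by
      have := hD (x j)
      tauto
    rcases hx with hx | hx
    · exact exists_row_prod hf₁ ⟨x, hxa, hx⟩ ⟨fun _ => b, rfl, hf₂.1 b⟩
    · obtain ⟨y, hy, hyi⟩ := h₂ i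
      rcases hD (y i) with h | h | h
      · exact exists_row_prod hf₁ (ha j) ⟨y, h, hy⟩
      · exact absurd h hyi
      · exact exists_row_prod hf₁ ⟨x, hxa, hx⟩ ⟨y, h, hy⟩
  have hf₂₁ := hf₂.prod hf₁
  refine collapsible_of_surjective (hf₃.prod hf₂₁) a ?_
  rintro ⟨i, p⟩ y
  have ha' : ∃ x : ι₂ × ι₁ → D, x p = a ∧ f₂ (fun i => f₁ fun j => x (i, j)) = a :=
    ⟨fun _ => a, rfl, hf₂₁.1 a⟩
  rcases hD y with rfl | rfl | rfl
  · exact exists_row_prod hf₂₁ ha' ⟨fun _ => y, rfl, hf₃.1 y⟩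
  · exact exists_row_prod hf₂₁ (hb p) ⟨fun _ => y, rfl, hf₃.1 y⟩
  · obtain ⟨z, hz, hzi⟩ := h₃ i
    rcases hD (z i) with h | h | h
    · exact exists_row_prod hf₂₁ ha' ⟨z, h, hz⟩
    · exact exists_row_prod hf₂₁ (hb p) ⟨z, h, hz⟩
    · exact absurd h hzi

/-- If every term had a coordinate controlling two disjoint nonempty sets at once, then tuples
alternating between these sets would not be generated by tuples with few switches. -/
theorem nonProj_of_switchable {F : Set Op} (hidem : ∀ g ∈ F, Idem g.2)
    (hsub : ∀ ρ ∈ Δ, InInv F ρ.2) (hsw : Switchable F) {S₀ S₁ : Set D} (h₀ : S₀.Nonempty)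
    (h₁ : S₁.Nonempty) (hdisj : Disjoint S₀ S₁) :
    NonProj Δ S₀ S₁ := by
  unfold NonProj
  by_contra! hcon
  obtain ⟨k, hk⟩ := hsw
  obtain ⟨a, ha⟩ := h₀
  obtain ⟨b, hb⟩ := h₁
  have key : ∀ t : Fin (k + 2) → D, InClosure F (SwitchSet (k + 2) k) t →
      ¬ ∀ d : Fin (k + 2), (d.1 % 2 = 0 → t d ∈ S₀) ∧ (d.1 % 2 = 1 → t d ∈ S₁) := by
    intro t ht
    induction ht with
    | @base t ht =>
      intro hbad
      have hsub' : ((Finset.univ.erase (Fin.last (k + 1)) : Finset (Fin (k + 2))) :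
          Set (Fin (k + 2))) ⊆ {i : Fin (k + 2) | ∃ h : i.1 + 1 < k + 2, t i ≠ t ⟨i.1 + 1, h⟩} := by
        intro i hi
        simp only [Finset.coe_erase, Finset.coe_univ, Set.mem_sdiff, Set.mem_univ, true_and,
          Set.mem_singleton_iff] at hi
        have hi' : i.1 + 1 < k + 2 := by
          have : i.1 ≠ k + 1 := fun h => hi (Fin.ext h)
          have := i.2
          omega
        refine ⟨hi', fun heq => ?_⟩
        have h1 := hbad i
        have h2 := hbad ⟨i.1 + 1, hi'⟩
        rcases Nat.mod_two_eq_zero_or_one i.1 with hm | hm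
        · have := h2.2 (by simp only; omega)
          rw [← heq] at this
          exact Set.disjoint_left.1 hdisj (h1.1 hm) this
        · have := h2.1 (by simp only; omega)
          rw [← heq] at this
          exact Set.disjoint_left.1 hdisj this (h1.2 hm)
      have h3 := Set.ncard_le_ncard hsub' (Set.toFinite _)
      rw [Set.ncard_coe_finset, Finset.card_erase_of_mem (Finset.mem_univ _), Finset.card_univ,
        Fintype.card_fin] at h3
      have h4 : _ ≤ k := ht
      omega
    | app f ts hf _ ih =>
      intro hbad
      obtain ⟨i, hi₀, hi₁⟩ := hcon _ f (isTerm_of_inClone hidem hsub hf)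
      exact ih i fun d => ⟨fun h => hi₀ _ ((hbad d).1 h), fun h => hi₁ _ ((hbad d).2 h)⟩
  refine key (fun d => if d.1 % 2 = 0 then a else b) (hk _ (by omega) _)
    fun d => ⟨fun h => ?_, fun h => ?_⟩
  · simpa [h] using ha
  · simpa [h] using hb

theorem Controls.eq_of_cover {S₀ S₁ : Set D} (hU : ∀ x, x ∈ S₀ ∨ x ∈ S₁) {ι : Type}
    {f : (ι → D) → D} {a b : D} (ha : a ∉ S₀) (hb : b ∉ S₁) {i j : ι} (hi : Controls f S₀ i)
    (hj : Controls f S₁ j) : i = j := by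
  classical
  by_contra hij
  let x : ι → D := fun k => if k = i then a else b
  rcases hU (f x) with h | h
  · exact ha (by simpa [x] using hi x h)
  · exact hb (by simpa [x, Ne.symm hij] using hj x h)

end Terms

/-- A clone of idempotent polymorphisms in which `{o}` and `{l}` are controlled, but never
together with a disjoint set. -/
structure Gap (Δ : Set RelD) (o l b : D) : Prop where
  cases : ∀ x : D, x = o ∨ x = l ∨ x = b
  o_ne_l : o ≠ l
  o_ne_b : o ≠ b
  l_ne_b : l ≠ b
  controlled_o : Controlled Δ {o}
  controlled_l : Controlled Δ {l}
  nonProj : NonProj Δ {o} {l}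
  nonProj_o : NonProj Δ {o} {l, b}
  nonProj_l : NonProj Δ {l} {o, b}

/-- `u` is a binary idempotent polymorphism of `Δ`. -/
def IsTerm₂ (Δ : Set RelD) (u : D → D → D) : Prop :=
  IsTerm Δ fun x : Bool → D => u (x true) (x false)

section Binary

variable {Δ : Set RelD}

theorem NonProj.symm {S₀ S₁ : Set D} (h : NonProj Δ S₀ S₁) : NonProj Δ S₁ S₀ := by
  obtain ⟨n, f, hf, h⟩ := h
  exact ⟨n, f, hf, fun i h₁ h₀ => h i h₀ h₁⟩

theorem IsTerm₂.self {u : D → D → D} (hu : IsTerm₂ Δ u) (x : D) : u x x = x :=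
  hu.1 x

theorem IsTerm₂.comp {u : D → D → D} (hu : IsTerm₂ Δ u) {ι : Type} {f g : (ι → D) → D}
    (hf : IsTerm Δ f) (hg : IsTerm Δ g) : IsTerm Δ fun x => u (f x) (g x) :=
  IsTerm.comp (g := fun c => cond c f g) hu (by rintro (_ | _) <;> assumption)

theorem IsTerm₂.gen {u : D → D → D} (hu : IsTerm₂ Δ u) {k m : ℕ} {s t : Fin m → D}
    (hs : Gen Δ k s) (ht : Gen Δ k t) : Gen Δ k fun d => u (s d) (t d) :=
  Gen.app (ts := fun c => cond c s t) hu (by rintro (_ | _) <;> assumption)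

theorem IsTerm.isTerm₂_ite {ι : Type} {f : (ι → D) → D} (hf : IsTerm Δ f) (p : ι → Prop)
    [DecidablePred p] : IsTerm₂ Δ fun x y => f fun i => if p i then x else y := by
  have h := hf.reindex fun i => decide (p i)
  unfold IsTerm₂
  convert h using 4 with x i
  by_cases hi : p i <;> simp [hi]

theorem IsTerm.isTerm₂_update {ι : Type} [DecidableEq ι] {f : (ι → D) → D} (hf : IsTerm Δ f)
    (i : ι) : IsTerm₂ Δ fun x y => f (Function.update (fun _ => y) i x) := by
  have h := hf.isTerm₂_ite fun k => k = i
  convert h using 4 with x y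
  funext k
  simp [Function.update_apply]

theorem Gen.const {k m : ℕ} (a : D) : Gen Δ k fun _ : Fin m => a :=
  Gen.of_eq_off a ∅ (by simp) fun _ _ => rfl

theorem Controlled.apply_ne {a : D} (h : Controlled Δ {a}) {ι : Type} [Fintype ι]
    {f : (ι → D) → D} (hf : IsTerm Δ f) {x : ι → D} (hx : ∀ i, x i ≠ a) : f x ≠ a := by
  obtain ⟨i, hi⟩ := h ι f hf
  exact fun hfx => hx i (hi x hfx)

theorem exists_controlled_pair (hnc : ¬ Collapsible (PolSet Δ))
    (hnp : ∀ S₀ S₁ : Set D, S₀.Nonempty → S₁.Nonempty → Disjoint S₀ S₁ → NonProj Δ S₀ S₁) :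
    ∃ p q : D, p ≠ q ∧ Controlled Δ {p} ∧ Controlled Δ {q} := by
  have compl : ∀ a b c : D, a ≠ b → a ≠ c → (∀ x : D, x = a ∨ x = b ∨ x = c) →
      Controlled Δ {a} → ¬ Controlled Δ {b, c} := by
    intro a b c hab hac hD ha hbc
    obtain ⟨n, f, hf, h⟩ := hnp {a} {b, c} (by simp) (by simp) (by simp [hab, hac])
    obtain ⟨i, hi⟩ := ha _ f hf
    obtain ⟨j, hj⟩ := hbc _ f hf
    have hij : i = j := Controls.eq_of_cover (fun x => by simpa using hD x) (a := b) (b := a)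
      (by simpa using hab.symm) (by simp [hab, hac]) hi hj
    exact h i hi (hij ▸ hj)
  have triple : Controlled Δ {1, 2} → Controlled Δ {0, 2} → ¬ Controlled Δ {0, 1} := by
    intro h₀ h₁ h₂
    obtain ⟨n, f, hf, h⟩ := hnp {0} {1} (by simp) (by simp) (by simp)
    obtain ⟨i, hi⟩ := h₀ _ f hf
    obtain ⟨j, hj⟩ := h₁ _ f hf
    obtain ⟨k, hk⟩ := h₂ _ f hf
    have hij : i = j := Controls.eq_of_cover (fun x => by fin_cases x <;> simp) (a := 0) (b := 1)
      (by simp) (by simp) hi hj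
    have hik : i = k := Controls.eq_of_cover (fun x => by fin_cases x <;> simp) (a := 0) (b := 2)
      (by simp) (by simp) hi hk
    subst hij hik
    refine h i (fun x hx => ?_) (fun x hx => ?_)
    · have hx0 : f x = 0 := hx
      have h1 := hj x (by simp [hx0])
      have h2 := hk x (by simp [hx0])
      simp only [Set.mem_insert_iff, Set.mem_singleton_iff] at h1 h2 ⊢
      rcases h1 with h1 | h1 <;> rcases h2 with h2 | h2 <;> simp_all
    · have hx1 : f x = 1 := hx
      have h1 := hi x (by simp [hx1])
      have h2 := hk x (by simp [hx1])
      simp only [Set.mem_insert_iff, Set.mem_singleton_iff] at h1 h2 ⊢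
      rcases h1 with h1 | h1 <;> rcases h2 with h2 | h2 <;> simp_all
  have e₀ := exists_controlled hnc (a := 0) (b := 1) (c := 2) (by decide)
  have e₁ := exists_controlled hnc (a := 1) (b := 0) (c := 2) (by decide)
  have e₂ := exists_controlled hnc (a := 2) (b := 0) (c := 1) (by decide)
  have c₀ := compl 0 1 2 (by decide) (by decide) (by decide)
  have c₁ := compl 1 0 2 (by decide) (by decide) (by decide)
  have c₂ := compl 2 0 1 (by decide) (by decide) (by decide)
  by_contra! hcon
  have d₀₁ := hcon 0 1 (by decide)
  have d₀₂ := hcon 0 2 (by decide)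
  have d₁₂ := hcon 1 2 (by decide)
  clear hcon compl hnp hnc
  grind only

theorem exists_gap (hnc : ¬ Collapsible (PolSet Δ))
    (hnp : ∀ S₀ S₁ : Set D, S₀.Nonempty → S₁.Nonempty → Disjoint S₀ S₁ → NonProj Δ S₀ S₁) :
    ∃ o l b : D, Gap Δ o l b := by
  obtain ⟨o, l, hol, ho, hl⟩ := exists_controlled_pair hnc hnp
  obtain ⟨b, hob, hlb, hD⟩ : ∃ b : D, o ≠ b ∧ l ≠ b ∧ ∀ x : D, x = o ∨ x = l ∨ x = b := by
    clear ho hl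
    revert o l
    decide
  exact ⟨o, l, b, hD, hol, hob, hlb, ho, hl, hnp _ _ (by simp) (by simp) (by simp [hol]),
    hnp _ _ (by simp) (by simp) (by simp [hol, hob]),
    hnp _ _ (by simp) (by simp) (by simp [hol.symm, hlb])⟩

end Binary

namespace Gap

variable {Δ : Set RelD} {o l b : D}

theorem swap (G : Gap Δ o l b) : Gap Δ l o b where
  cases x := by have := G.cases x; tauto
  o_ne_l := G.o_ne_l.symm
  o_ne_b := G.l_ne_b
  l_ne_b := G.o_ne_b
  controlled_o := G.controlled_l
  controlled_l := G.controlled_o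
  nonProj := G.nonProj.symm
  nonProj_o := G.nonProj_l
  nonProj_l := G.nonProj_o

theorem eq_b (G : Gap Δ o l b) {x : D} (ho : x ≠ o) (hl : x ≠ l) : x = b := by
  have := G.cases x
  tauto

theorem exists_conv (G : Gap Δ o l b) : ∃ B : D → D → D, IsTerm₂ Δ B ∧
    (∀ x, B x l = if x = l then l else b) ∧ ∀ y, B o y = if y = o then o else b := by
  classical
  obtain ⟨n, g, hg, h⟩ := G.nonProj
  obtain ⟨j, hj⟩ := G.controlled_o _ g hg
  obtain ⟨i, hi⟩ := G.controlled_l _ g hg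
  refine ⟨fun x y => g fun k => if Controls g {l} k then x else y, hg.isTerm₂_ite _,
    fun x => ?_, fun y => ?_⟩
  · split_ifs with hx
    · simp [hx, hg.1]
    · refine G.eq_b (fun hv => G.o_ne_l ?_) fun hv => hx ?_
      · simpa [h j hj] using (hj _ hv).symm
      · simpa [hi] using hi _ hv
  · split_ifs with hy
    · simp [hy, hg.1]
    · refine G.eq_b (fun hv => hy ?_) fun hv => G.o_ne_l ?_
      · simpa [h j hj] using hj _ hv
      · simpa [hi] using hi _ hv

theorem gen_of_ne_o (G : Gap Δ o l b) {k m : ℕ} (hk : 1 ≤ k) {t : Fin m → D}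
    (ht : ∀ d, t d ≠ o) : Gen Δ k t := by
  classical
  obtain ⟨B, hB, hBl, -⟩ := G.exists_conv
  have conv : ∀ t : Fin m → D, Gen Δ k t → Gen Δ k fun d => if t d = l then l else b := by
    intro t ht
    simpa only [hBl] using hB.gen ht (Gen.const l)
  have main : ∀ W : Finset (Fin m), Gen Δ k fun d => if d ∈ W then b else l := by
    intro W
    induction W using Finset.induction_on with
    | empty => simpa using Gen.const l
    | insert d W hd ih =>
      obtain ⟨n, f, hf, h⟩ := G.nonProj_l
      obtain ⟨i, hi⟩ := G.controlled_l _ f hf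
      obtain ⟨x, hx, hxi⟩ : ∃ x, f x ≠ l ∧ x i = l := by
        have := h i hi
        simp only [Controls, not_forall] at this
        obtain ⟨x, hx, hxi⟩ := this
        refine ⟨x, ?_, ?_⟩
        · rintro hl
          simp [hl, G.o_ne_l.symm, G.l_ne_b] at hx
        · have := G.cases (x i)
          simp only [Set.mem_insert_iff, Set.mem_singleton_iff] at hxi
          tauto
      by_cases hz : f (Function.update (fun _ => b) i l) = l
      · have hg : Gen Δ k fun e => f (if e = d then x else if e ∈ W then fun _ => b else
            Function.update (fun _ => b) i l) := by
          refine Gen.of_rows hf (fun e => if e = d then x else if e ∈ W then fun _ => b else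
            Function.update (fun _ => b) i l) (fun _ => rfl) fun c => ?_
          by_cases hc : c = i
          · subst hc
            convert ih using 2 with e
            by_cases hed : e = d
            · subst hed
              simp [hd, hxi]
            · by_cases heW : e ∈ W <;> simp [hed, heW]
          · refine Gen.of_eq_off b {d} (by simpa using hk) fun e he => ?_
            have hed : e ≠ d := by simpa using he
            by_cases heW : e ∈ W <;> simp [hed, heW, hc]
        convert conv _ hg using 2 with e
        by_cases hed : e = d
        · simp [hed, hx]
        · by_cases heW : e ∈ W <;> simp [hed, heW, hz, hf.1, G.l_ne_b.symm]
      · have hu := hf.isTerm₂_update i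
        have h₁ : Gen Δ k fun e => if e = d then b else l :=
          Gen.of_eq_off l {d} (by simpa using hk) fun e he => by
            have hed : e ≠ d := by simpa using he
            simp [hed]
        convert hu.gen h₁ ih using 2 with e
        by_cases hed : e = d
        · subst hed
          simp only [Finset.mem_insert, true_or, if_true, hd, if_false]
          refine (G.eq_b (G.controlled_o.apply_ne hf fun c => ?_) fun hv => G.l_ne_b ?_).symm
          · by_cases hc : c = i
            · simp [hc, G.o_ne_b.symm]
            · simp [hc, G.o_ne_l.symm]
          · simpa using (hi _ hv).symm
        · by_cases heW : e ∈ W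
          · simp only [Finset.mem_insert, hed, heW, or_true, if_true, if_false]
            refine (G.eq_b (G.controlled_o.apply_ne hf fun c => ?_) hz).symm
            by_cases hc : c = i
            · simp [hc, G.o_ne_l.symm]
            · simp [hc, G.o_ne_b.symm]
          · simp [hed, heW, hf.1]
  convert main (Finset.univ.filter fun d => t d = b) using 2 with d
  have h₁ := G.cases (t d)
  have h₂ := ht d
  by_cases hb : t d = b
  · simp [hb]
  · simp only [Finset.mem_filter, Finset.mem_univ, true_and, hb, if_false]
    tauto

theorem gen_of_ne_l (G : Gap Δ o l b) {k m : ℕ} (hk : 1 ≤ k) {t : Fin m → D}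
    (ht : ∀ d, t d ≠ l) : Gen Δ k t :=
  G.swap.gen_of_ne_o hk ht

theorem exists_meet_o (G : Gap Δ o l b) (hnc : ¬ Collapsible (PolSet Δ)) :
    ∃ u : D → D → D, IsTerm₂ Δ u ∧ u o b = b ∧ u b o = b := by
  classical
  obtain ⟨n, g, hg, h⟩ := G.nonProj
  obtain ⟨j, hj⟩ := G.controlled_o _ g hg
  obtain ⟨x, hx, hxj⟩ : ∃ x, g x = l ∧ x j ≠ l := by
    have := h j hj
    simpa [Controls] using this
  have hne : ∀ x y : D, x ≠ l → y ≠ l → ∀ c, Function.update (fun _ : Fin n => y) j x c ≠ l := by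
    intro x y hx hy c
    by_cases hc : c = j
    · simpa [hc] using hx
    · simpa [hc] using hy
  refine ⟨_, hg.isTerm₂_update j, G.eq_b (fun hc => hnc ⟨1, fun m _ t => ?_⟩)
    (G.controlled_l.apply_ne hg (hne _ _ G.o_ne_l G.l_ne_b.symm)), G.eq_b (fun hc => ?_)
    (G.controlled_l.apply_ne hg (hne _ _ G.l_ne_b.symm G.o_ne_l))⟩
  · refine Gen.of_rows hg (fun d => if t d = o then Function.update (fun _ => b) j o else
      if t d = l then x else fun _ => b) (fun d => ?_) fun c => ?_
    · rcases G.cases (t d) with h | h | h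
      · simp [h, hc]
      · simp [h, hx, G.o_ne_l.symm]
      · simp [h, G.o_ne_b.symm, G.l_ne_b.symm, hg.1]
    · by_cases hcl : x c = l
      · have hcj : c ≠ j := by
          rintro rfl
          exact hxj hcl
        refine G.gen_of_ne_o le_rfl fun d => ?_
        split_ifs <;> simp [hcj, hcl, G.o_ne_b.symm, G.o_ne_l.symm]
      · refine G.gen_of_ne_l le_rfl fun d => ?_
        split_ifs
        · exact hne _ _ G.o_ne_l G.l_ne_b.symm c
        · exact hcl
        · exact G.l_ne_b.symm
  · exact G.o_ne_b (by simpa using (hj _ hc).symm)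

theorem apply_o_b_or_apply_b_o_eq_b (G : Gap Δ o l b) {u : D → D → D} (hu : IsTerm₂ Δ u) :
    u o b = b ∨ u b o = b := by
  obtain ⟨i, hi⟩ := G.controlled_o _ _ hu
  have key : ∀ c : Bool → D, (∀ k, c k ≠ l) → c i = b → u (c true) (c false) = b := by
    intro c hc hci
    refine G.eq_b (fun hv => G.o_ne_b ?_) (G.controlled_l.apply_ne hu hc)
    exact (hi c hv).symm.trans hci
  cases i with
  | false =>
    exact .inl (key (fun c => cond c o b) (by simp [G.o_ne_l, G.l_ne_b.symm]) rfl)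
  | true =>
    exact .inr (key (fun c => cond c b o) (by simp [G.o_ne_l, G.l_ne_b.symm]) rfl)

theorem meet_isTerm₂ (G : Gap Δ o l b) (hnc : ¬ Collapsible (PolSet Δ)) :
    IsTerm₂ Δ fun x y => if x = y then x else b := by
  obtain ⟨u₀, hu₀, h₀ob, h₀bo⟩ := G.exists_meet_o hnc
  obtain ⟨u₁, hu₁, h₁lb, h₁bl⟩ := G.swap.exists_meet_o hnc
  obtain ⟨B, hB, hBl, hBo⟩ := G.exists_conv
  have hne : ∀ x y : D, x ≠ l → y ≠ l → u₁ x y ≠ l := fun x y hx hy =>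
    G.controlled_l.apply_ne hu₁ (x := fun c => cond c x y) (by simp [hx, hy])
  have hob : u₀ (u₁ o b) (u₁ b o) = b ∧ u₀ (u₁ b o) (u₁ o b) = b := by
    have h₁ := hne o b G.o_ne_l G.l_ne_b.symm
    have h₂ := hne b o G.l_ne_b.symm G.o_ne_l
    have h₃ := G.cases (u₁ o b)
    have h₄ := G.cases (u₁ b o)
    have h₅ := hu₀.self b
    rcases G.apply_o_b_or_apply_b_o_eq_b hu₁ with h | h
    · rw [h]
      rcases h₄ with h' | h' | h' <;> simp_all
    · rw [h]
      rcases h₃ with h' | h' | h' <;> simp_all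
  have ht : ∀ x, u₀ (u₁ x b) (u₁ b x) = b ∧ u₀ (u₁ b x) (u₁ x b) = b := by
    intro x
    rcases G.cases x with rfl | rfl | rfl
    · exact hob
    · rw [h₁lb, h₁bl]
      exact ⟨hu₀.self b, hu₀.self b⟩
    · simp [hu₀.self, hu₁.self]
  have hT : IsTerm₂ Δ fun x y => u₀ (u₁ x y) (u₁ y x) :=
    hu₀.comp hu₁ (hu₁.comp (isTerm_proj _) (isTerm_proj _))
  have hS := hT.comp hB (hB.comp (isTerm_proj false) (isTerm_proj true))
  unfold IsTerm₂
  convert hS using 2 with x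
  generalize x true = p
  generalize x false = q
  dsimp only
  split_ifs with hpq
  · subst hpq
    simp [hu₀.self, hu₁.self, hB.self]
  · have : B p q = b ∨ B q p = b := by
      have e₁ := hBl b
      have e₂ := hBo b
      have e₃ := hBo l
      rw [if_neg G.l_ne_b.symm] at e₁
      rw [if_neg G.o_ne_b.symm] at e₂
      rw [if_neg G.o_ne_l.symm] at e₃
      have hp := G.cases p
      have hq := G.cases q
      rcases hp with rfl | rfl | rfl <;> rcases hq with rfl | rfl | rfl <;> simp_all
    rcases this with h | h
    · rw [h, (ht _).2]
    · rw [h, (ht _).1]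

end Gap

/-- The multicolour Ramsey theorem for triangles, on a linear order. -/
theorem exists_monochromatic_triangle (h : ℕ) : ∃ N : ℕ, ∀ {α κ : Type} [LinearOrder α]
    [DecidableEq κ] (C : Finset κ) (χ : α → α → κ) (S : Finset α), C.card ≤ h → N ≤ S.card →
    (∀ a ∈ S, ∀ b ∈ S, a < b → χ a b ∈ C) →
    ∃ a b c, a ∈ S ∧ b ∈ S ∧ c ∈ S ∧ a < b ∧ b < c ∧ χ b c = χ a b ∧ χ a c = χ a b := by
  induction h with
  | zero =>
    refine ⟨2, fun C χ S hC hS hχ => ?_⟩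
    obtain ⟨a, ha, b, hb, hab⟩ := Finset.one_lt_card.1 (show 1 < S.card by omega)
    have hC' : C = ∅ := by simpa using hC
    subst hC'
    rcases lt_or_gt_of_ne hab with hab | hab
    · simpa using hχ a ha b hb hab
    · simpa using hχ b hb a ha hab
  | succ h ih =>
    obtain ⟨N, ih⟩ := ih
    refine ⟨(h + 1) * N + 2, fun {α κ} _ _ C χ S hC hS hχ => ?_⟩
    have hne : S.Nonempty := Finset.card_pos.1 (by omega)
    have ha := S.min'_mem hne
    have hlt : ∀ x ∈ S.erase (S.min' hne), S.min' hne < x := fun x hx =>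
      S.min'_lt_of_mem_erase_min' hne hx
    generalize S.min' hne = a at ha hlt
    have hcard : C.card * N < (S.erase a).card := by
      rw [Finset.card_erase_of_mem ha]
      have := Nat.mul_le_mul_right N hC
      omega
    obtain ⟨c, hc, hN⟩ := Finset.exists_lt_card_fiber_of_mul_lt_card_of_maps_to
      (f := fun x => χ a x) (fun x hx => hχ a ha x (Finset.mem_of_mem_erase hx) (hlt x hx)) hcard
    have hfib : ∀ x ∈ (S.erase a).filter fun x => χ a x = c, x ∈ S ∧ a < x ∧ χ a x = c := by
      intro x hx
      rw [Finset.mem_filter] at hx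
      exact ⟨Finset.mem_of_mem_erase hx.1, hlt x hx.1, hx.2⟩
    by_cases hpq : ∃ p q, p ∈ (S.erase a).filter (fun x => χ a x = c) ∧
        q ∈ (S.erase a).filter (fun x => χ a x = c) ∧ p < q ∧ χ p q = c
    · obtain ⟨p, q, hp, hq, hlt', hχc⟩ := hpq
      obtain ⟨hpS, hap, hpc⟩ := hfib p hp
      obtain ⟨hqS, -, hqc⟩ := hfib q hq
      exact ⟨a, p, q, ha, hpS, hqS, hap, hlt', hχc.trans hpc.symm, hqc.trans hpc.symm⟩
    · push Not at hpq
      obtain ⟨p, q, r, hp, hq, hr, hpqr⟩ := ih (C.erase c) χ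
        ((S.erase a).filter fun x => χ a x = c)
        (by rw [Finset.card_erase_of_mem hc]; omega) hN.le fun p hp q hq hlt' =>
          Finset.mem_erase.2 ⟨hpq p q hp hq hlt',
            hχ p (hfib p hp).1 q (hfib q hq).1 hlt'⟩
      exact ⟨p, q, r, (hfib p hp).1, (hfib q hq).1, (hfib r hr).1, hpqr⟩

namespace Gap

variable {Δ : Set RelD} {o l b : D}

theorem exists_controls_of_apply_eq_o (G : Gap Δ o l b) (hnc : ¬ Collapsible (PolSet Δ))
    {ι : Type} [Fintype ι] {g : (ι → D) → D} (hg : IsTerm Δ g) {u : ι → D} (hu : g u = o) :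
    ∃ i, Controls g {l} i ∧ u i = o := by
  classical
  have hs := G.meet_isTerm₂ hnc
  by_contra! hcon
  have hv : ∀ i, ∃ v, g v = l ∧ (u i = o → v i ≠ l) := by
    intro i
    by_cases hi : u i = o
    · have := fun h => hcon i h hi
      simp only [Controls, Set.mem_singleton_iff, not_forall, imp_false] at this
      obtain ⟨v, hv, hvi⟩ := this
      exact ⟨v, hv, fun _ => hvi⟩
    · exact ⟨fun _ => l, hg.1 l, fun h => absurd h hi⟩
  choose v hvl hvo using hv
  have hlo := G.o_ne_l.symm
  have hbo := G.o_ne_b.symm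
  have hbl := G.l_ne_b.symm
  refine hnc ⟨Fintype.card (ι × Bool) + 1, fun m _ => ?_⟩
  have hchi : ∀ O : Finset (Fin m),
      Gen Δ (Fintype.card (ι × Bool) + 1) fun d => if d ∈ O then l else o := by
    intro O
    induction O using Finset.strongInduction with
    | H O ih =>
      have pair : ∀ (Y : Fin m → D) (d d' : Fin m), (∀ e, e ∉ O → Y e = o) → d ∈ O → d' ∈ O →
          d ≠ d' → Y d ≠ l → Y d' = Y d → Gen Δ (Fintype.card (ι × Bool) + 1) Y := by
        intro Y d d' hY hd hd' hdd hYd hYd'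
        have h₁ := ih (O.filter fun e => Y e = l ∨ Y e = b ∧ e ≠ d)
          ((Finset.filter_ssubset).2 ⟨d, hd, by simp [hYd]⟩)
        have h₂ := ih (O.filter fun e => Y e = l ∨ Y e = b ∧ e = d)
          ((Finset.filter_ssubset).2 ⟨d', hd', by simp [hYd', hYd, hdd.symm]⟩)
        convert hs.gen h₁ h₂ using 2 with e
        by_cases he : e ∈ O
        · rcases G.cases (Y e) with h | h | h
          · simp [he, h, G.o_ne_l, G.o_ne_b]
          · simp [he, h]
          · by_cases hed : e = d
            · subst hed
              simp [he, h, hbl, hlo.symm]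
            · simp [he, h, hed, hbl, hlo]
        · simp [he, hY e he]
      rcases Nat.le_total O.card (Fintype.card (ι × Bool)) with hc | hc
      · exact Gen.of_eq_off o O (by omega) fun d hd => by simp [hd]
      obtain ⟨e, he, heO⟩ := exists_injective_into O hc
      let R : Fin m → ι → D := fun d => if d ∉ O then u else
        if h : ∃ c, e c = d then v h.choose.1 else fun _ => l
      have hRoff : ∀ d, d ∉ O → R d = u := fun d hd => by simp [R, hd]
      have hRe : ∀ c, R (e c) = v c.1 := by
        intro c
        have h : ∃ c', e c' = e c := ⟨c, rfl⟩
        have hc' : h.choose = c := he h.choose_spec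
        simp only [R, heO, not_true_eq_false, if_false, dif_pos h]
        rw [hc']
      have hRl : ∀ d, d ∈ O → (¬ ∃ c, e c = d) → R d = fun _ => l := fun d hd h => by
        simp only [R, hd, not_true_eq_false, if_false, dif_neg h]
      have hlist : ∀ X : Fin m → D, (∀ d, (¬ ∃ c, e c = d) → X d = l) →
          Gen Δ (Fintype.card (ι × Bool) + 1) X := fun X hX =>
        Gen.of_eq_off l (Finset.univ.image e) (Finset.card_image_le.trans (by simp))
          fun d hd => hX d (by simpa using hd)
      refine Gen.of_rows hg R (fun d => ?_) fun i => ?_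
      · by_cases hd : d ∈ O
        · by_cases h : ∃ c, e c = d
          · obtain ⟨c, rfl⟩ := h
            simp [hRe, hvl, heO]
          · simp [hRl d hd h, hg.1, hd]
        · simp [hRoff d hd, hu, hd]
      · rcases G.cases (u i) with hi | hi | hi
        · refine pair _ (e (i, true)) (e (i, false)) (fun d hd => ?_) (heO _) (heO _)
            (fun h => by simpa using he h) ?_ ?_
          · simp only [hRoff d hd, hi]
          · simpa only [hRe] using hvo i hi
          · simp only [hRe]
        · refine hlist _ fun d h => ?_
          by_cases hd : d ∈ O
          · simp only [hRl d hd h]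
          · simp only [hRoff d hd, hi]
        · by_cases hall : ∀ j, v j i = l
          · refine G.gen_of_ne_o (by omega) fun d => ?_
            by_cases hd : d ∈ O
            · by_cases h : ∃ c, e c = d
              · obtain ⟨c, rfl⟩ := h
                simp [hRe, hall, hlo]
              · simp [hRl d hd h, hlo]
            · simp [hRoff d hd, hi, hbo]
          · push Not at hall
            obtain ⟨j, hj⟩ := hall
            have h₁ : Gen Δ (Fintype.card (ι × Bool) + 1) fun d => if d ∈ O then R d i else o := by
              refine pair _ (e (j, true)) (e (j, false)) (fun d hd => if_neg hd) (heO _) (heO _)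
                (fun h => by simpa using he h) ?_ ?_
              · simpa only [hRe, heO, if_true] using hj
              · simp only [hRe, heO]
            have h₂ : Gen Δ (Fintype.card (ι × Bool) + 1) fun d => if d ∈ O then R d i else l := by
              refine hlist _ fun d h => ?_
              by_cases hd : d ∈ O
              · simp [hRl d hd h]
              · simp [hd]
            convert hs.gen h₁ h₂ using 2 with d
            by_cases hd : d ∈ O
            · simp [hd]
            · simp [hd, hRoff d hd, hi, G.o_ne_l]
  intro t
  have h₁ := hchi (Finset.univ.filter fun d => t d = l)
  have h₂ := hchi (Finset.univ.filter fun d => t d ≠ o)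
  convert hs.gen h₁ h₂ using 2 with d
  rcases G.cases (t d) with h | h | h
  · simp [h, G.o_ne_l]
  · simp [h, hlo]
  · simp [h, hbl, hbo, G.o_ne_l]

/-- A quaternary polymorphism detecting whether an edge labelling is compatible on a triangle. -/
theorem exists_triangle_op (G : Gap Δ o l b) (hnc : ¬ Collapsible (PolSet Δ)) :
    ∃ T : D → D → D → D → D, IsTerm Δ (fun x : Fin 4 → D => T (x 0) (x 1) (x 2) (x 3)) ∧
      T o o l l = o ∧ T o l o l = o ∧
      (∀ x y z, x ≠ o → y ≠ o → z ≠ o → T o x y z ≠ o) ∧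
      ∀ w x y z, T w x y z = l → x = l := by
  classical
  have hs := G.meet_isTerm₂ hnc
  obtain ⟨n, g, hg, h⟩ := G.nonProj
  let Z : (Fin n → D) → Finset (Fin n) := fun u =>
    Finset.univ.filter fun i => Controls g {l} i ∧ u i = o
  obtain ⟨u, hu, hmin⟩ := Finset.exists_min_image
    (Finset.univ.filter fun u : Fin n → D => g u = o) (fun u => (Z u).card)
    ⟨fun _ => o, by simp [hg.1]⟩
  simp only [Finset.mem_filter, Finset.mem_univ, true_and] at hu hmin
  obtain ⟨i, hil, hui⟩ := G.exists_controls_of_apply_eq_o hnc hg hu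
  obtain ⟨u', hu', hu'i⟩ : ∃ u', g u' = o ∧ u' i ≠ o := by
    have := fun h' => h i h' hil
    simpa [Controls] using this
  have hlo := G.o_ne_l.symm
  have hbo := G.o_ne_b.symm
  have hbl := G.l_ne_b.symm
  let s : D → D → D := fun x y => if x = y then x else b
  let P : D → D → D → D → D → D → D := fun p q w x y z =>
    if p = o then (if q = o then w else if q = l then x else s w x)
    else if p = l then (if q = o then y else if q = l then z else s z y)
    else (if q = o then s w y else if q = l then s z x else s w z)
  refine ⟨fun w x y z => g fun k => P (u k) (u' k) w x y z, hg.comp fun k => ?_, ?_, ?_,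
    fun x y z hx hy hz hgo => ?_, fun w x y z hgl => ?_⟩
  · simp only [P]
    split_ifs
    exacts [isTerm_proj _, isTerm_proj _, hs.comp (isTerm_proj _) (isTerm_proj _),
      isTerm_proj _, isTerm_proj _, hs.comp (isTerm_proj _) (isTerm_proj _),
      hs.comp (isTerm_proj _) (isTerm_proj _), hs.comp (isTerm_proj _) (isTerm_proj _),
      hs.comp (isTerm_proj _) (isTerm_proj _)]
  · refine Eq.trans (congrArg g (funext fun k => ?_)) hu
    rcases G.cases (u k) with h₁ | h₁ | h₁ <;> rcases G.cases (u' k) with h₂ | h₂ | h₂ <;>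
      simp [P, s, h₁, h₂, hlo, hbo, hbl, hlo.symm]
  · refine Eq.trans (congrArg g (funext fun k => ?_)) hu'
    rcases G.cases (u k) with h₁ | h₁ | h₁ <;> rcases G.cases (u' k) with h₂ | h₂ | h₂ <;>
      simp [P, s, h₁, h₂, hlo, hbo, hbl, hlo.symm]
  · have hP : ∀ k, P (u k) (u' k) o x y z = o → u k = o ∧ u' k = o := by
      intro k
      rcases G.cases (u k) with h₁ | h₁ | h₁ <;> rcases G.cases (u' k) with h₂ | h₂ | h₂ <;>
        simp [P, s, h₁, h₂, hlo, hbo, hbl, hx, hy, hz, hx.symm, hy.symm, hz.symm] <;>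
        split_ifs <;> simp [hz, hbo]
    refine absurd (hmin _ hgo) (not_le.2 (Finset.card_lt_card ⟨fun k hk => ?_, fun hsub => ?_⟩))
    · simp only [Z, Finset.mem_filter, Finset.mem_univ, true_and] at hk ⊢
      exact ⟨hk.1, (hP k hk.2).1⟩
    · have hi : i ∈ Z u := by simp [Z, hil, hui]
      have := hsub hi
      simp only [Z, Finset.mem_filter, Finset.mem_univ, true_and] at this
      exact hu'i (hP i this.2).2
  · have hi := hil _ hgl
    simp only [P, s, hui, hu'i, Set.mem_singleton_iff, if_true, if_false] at hi
    split_ifs at hi with h₁ h₂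
    · exact hi
    · exact h₂ ▸ hi
    · exact absurd hi hbl

theorem exists_meet_family (G : Gap Δ o l b) (hnc : ¬ Collapsible (PolSet Δ)) {ρ : RelD}
    (hρ : ρ ∈ Δ) {γ : Type} {S : Finset γ} (hS : S.Nonempty) (w : γ → Fin ρ.1 → D)
    (hw : ∀ c ∈ S, w c ∈ ρ.2) :
    ∃ z ∈ ρ.2, ∀ j, ∀ v, v ≠ b → (z j = v ↔ ∀ c ∈ S, w c j = v) := by
  induction hS using Finset.Nonempty.cons_induction with
  | singleton a => exact ⟨w a, hw a (by simp), by simp⟩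
  | cons a S ha hS ih =>
    obtain ⟨z, hz, h⟩ := ih fun c hc => hw c (by simp [hc])
    refine ⟨_, (G.meet_isTerm₂ hnc).2 ρ hρ (fun c => cond c (w a) z) ?_, fun j v hv => ?_⟩
    · rintro (_ | _)
      · exact hz
      · exact hw a (by simp)
    · simp only [cond_true, cond_false, Finset.mem_cons, forall_eq_or_imp, ← h j v hv]
      split_ifs with he
      · rw [← he, and_self]
      · refine ⟨fun h' => absurd h'.symm hv, ?_⟩
        rintro ⟨rfl, h'⟩
        exact absurd h'.symm he

theorem not_finite (G : Gap Δ o l b) (hnc : ¬ Collapsible (PolSet Δ)) (hfin : Δ.Finite) :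
    False := by
  classical
  have hs := G.meet_isTerm₂ hnc
  obtain ⟨T, hT, hT₁, hT₂, hTo, hTl⟩ := G.exists_triangle_op hnc
  have hTs : ∀ a, T a a a a = a := hT.1
  obtain ⟨h, hh⟩ := (hfin.image Sigma.fst).bddAbove
  have hh' : ∀ ρ ∈ Δ, ρ.1 ≤ h := fun ρ hρ => hh ⟨ρ, hρ, rfl⟩
  obtain ⟨N, hN⟩ := exists_monochromatic_triangle h
  let V := Fin (N + 3)
  let Q : D → (V × V → D) → Prop := fun a y =>
    ∀ p q r : V, p < q → q < r → T a (y (p, q)) (y (q, r)) (y (p, r)) = a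
  let last : V := Fin.last _
  have h01 : (0 : V) < 1 := by simp [V]
  have h1l : (1 : V) < last := by simp [V, last, Fin.lt_def]
  let f : (V × V → D) → D := fun y => if Q o y then o else if Q l y then l else b
  have hQo : ∀ a, a ≠ o → ¬ Q o fun _ => a := fun a ha hQ =>
    hTo a a a ha ha ha (hQ 0 1 last h01 h1l)
  have hf : IsTerm Δ f := by
    refine ⟨fun a => ?_, fun ρ hρ t ht => ?_⟩
    · rcases G.cases a with rfl | rfl | rfl
      · exact if_pos fun _ _ _ _ _ => hTs _
      · simp only [f]
        rw [if_neg (hQo _ G.o_ne_l.symm), if_pos fun _ _ _ _ _ => hTs _]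
      · simp only [f]
        rw [if_neg (hQo _ G.o_ne_b.symm), if_neg]
        exact fun hQ => G.l_ne_b (hTl _ _ _ _ (hQ 0 1 last h01 h1l)).symm
    obtain ⟨p₀, q₀, hpq, hql, hedge⟩ : ∃ p₀ q₀ : V, p₀ < q₀ ∧ q₀ < last ∧
        ∀ j, Q o (fun c => t c j) → t (p₀, q₀) j = o := by
      by_contra! hcon
      obtain ⟨j₀, -⟩ := hcon 0 1 h01 h1l
      have hcol : ∀ p q : V, ∃ j, p < q → q < last →
          Q o (fun c => t c j) ∧ t (p, q) j ≠ o := by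
        intro p q
        by_cases hpq : p < q ∧ q < last
        · obtain ⟨j, hj⟩ := hcon p q hpq.1 hpq.2
          exact ⟨j, fun _ _ => hj⟩
        · exact ⟨j₀, fun h₁ h₂ => absurd ⟨h₁, h₂⟩ hpq⟩
      choose χ hχ using hcol
      obtain ⟨p, q, r, -, -, hr, hpq, hqr, h₁, h₂⟩ := hN Finset.univ χ
        (Finset.univ.erase last) (by simpa using hh' ρ hρ) (by simp [V])
        fun _ _ _ _ _ => Finset.mem_univ _
      have hrl : r < last := lt_of_le_of_ne (Fin.le_last r) (by simpa using hr)
      obtain ⟨hQ, hpq'⟩ := hχ p q hpq (hqr.trans hrl)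
      obtain ⟨-, hqr'⟩ := hχ q r hqr hrl
      obtain ⟨-, hpr'⟩ := hχ p r (hpq.trans hqr) hrl
      rw [h₁] at hqr'
      rw [h₂] at hpr'
      exact hTo _ _ _ hpq' hqr' hpr' (hQ p q r hpq hqr)
    let s : D → D → D := fun x y => if x = y then x else b
    have hsv : ∀ x y v, v ≠ b → s x y = v → x = v ∧ y = v := by
      intro x y v hv hxy
      simp only [s] at hxy
      split_ifs at hxy with he
      · exact ⟨hxy, he ▸ hxy⟩
      · exact absurd hxy.symm hv
    let w : V × V × V → Fin ρ.1 → D := fun c j =>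
      s (t (p₀, q₀) j) (T (t (p₀, q₀) j) (t (c.1, c.2.1) j) (t (c.2.1, c.2.2) j) (t (c.1, c.2.2) j))
    have hw : ∀ c, w c ∈ ρ.2 := by
      intro c
      exact (hs.comp (isTerm_proj (0 : Fin 4)) hT).2 ρ hρ
        ![t (p₀, q₀), t (c.1, c.2.1), t (c.2.1, c.2.2), t (c.1, c.2.2)]
        (by intro i; fin_cases i <;> exact ht _)
    obtain ⟨z, hz, hzw⟩ := G.exists_meet_family hnc hρ
      (S := Finset.univ.filter fun c : V × V × V => c.1 < c.2.1 ∧ c.2.1 < c.2.2)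
      ⟨(p₀, q₀, last), by simp [hpq, hql]⟩ w fun c _ => hw c
    convert hz using 1
    funext j
    simp only [Finset.mem_filter, Finset.mem_univ, true_and, Prod.forall, and_imp] at hzw
    have hzQ : ∀ v, v ≠ b → z j = v → Q v fun c => t c j := by
      intro v hv hzv p q r hpq' hqr'
      obtain ⟨h₁, h₂⟩ := hsv _ _ v hv ((hzw j v hv).1 hzv p q r hpq' hqr')
      rwa [h₁] at h₂
    have hQz : ∀ v, v ≠ b → t (p₀, q₀) j = v → (Q v fun c => t c j) → z j = v := by
      intro v hv htv hQ
      refine (hzw j v hv).2 fun p q r hpq' hqr' => ?_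
      simp [w, s, htv, hQ p q r hpq' hqr']
    simp only [f]
    split_ifs with h₁ h₂
    · exact (hQz o G.o_ne_b (hedge j h₁) h₁).symm
    · exact (hQz l G.l_ne_b (hTl _ _ _ _ (h₂ p₀ q₀ last hpq hql)) h₂).symm
    · exact (G.eq_b (fun hzo => h₁ (hzQ o G.o_ne_b hzo)) fun hzl => h₂ (hzQ l G.l_ne_b hzl)).symm
  obtain ⟨⟨a, c⟩, hac⟩ := G.controlled_o _ f hf
  let y : V × V → D := fun e => if e.1 < e.2 ∧ (e.1 ≤ a → e.2 ≤ a) then o else l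
  have hy : Q o y := by
    intro p q r hpq hqr
    have hpr := hpq.trans hqr
    by_cases h₁ : p ≤ a <;> by_cases h₂ : q ≤ a <;> by_cases h₃ : r ≤ a <;>
      first
        | exact absurd (hpq.le.trans h₂) h₁
        | exact absurd (hqr.le.trans h₃) h₂
        | simp [y, hpq, hqr, hpr, h₁, h₂, h₃, hTs, hT₁, hT₂]
  have hyac : y (a, c) = o := hac y (if_pos hy)
  have hyl : y (a, c) = l := if_neg fun h' => absurd (h'.2 le_rfl) (not_le.2 h'.1)
  exact G.o_ne_l (hyac.symm.trans hyl)

end Gap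

theorem statement19 (F : Set Op)
    (hidem : ∀ g ∈ F, Idem g.2)
    (hsw : Switchable F)
    (Δ : Set RelD) (hfin : Δ.Finite) (hsub : ∀ ρ ∈ Δ, InInv F ρ.2) :
    Collapsible (PolSet Δ) := by
  by_contra hnc
  obtain ⟨o, l, b, G⟩ := exists_gap hnc fun _ _ => nonProj_of_switchable hidem hsub hsw
  exact G.not_finite hnc hfin
end
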